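/- arXiv:1009.0176 — 4 statements merged into one kernel-verified Lean document; each statement's English description precedes it below -/
import Mathlib

section
/- For every natural number n, the number of noncrossing linked partitions of the set {1,2,...,n+1} equals the number of large (3,2)-Motzkin paths of length n. (This is the cardinality form of the paper's main theorem, which establishes an explicit bijection between the two sets.) -/
/-- Steps of a (3,2)-Motzkin path: one up step, two colored down steps,
three colored level steps. -/
inductive MStep : Type
  | U | D1 | D2 | L1 | L2 | L3
  deriving DecidableEq

/-- Height contribution of a single step. -/
def MStep.height : MStep → ℤ
  | .U  => 1
  | .D1 => -1
  | .D2 => -1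
  | .L1 => 0
  | .L2 => 0
  | .L3 => 0

/-- Total height of a list of steps. -/
def mHeight (p : List MStep) : ℤ := (p.map MStep.height).sum

/-- A (3,2)-Motzkin path: all prefixes have nonnegative height and the
total height is 0. -/
def IsMotzkin32 (p : List MStep) : Prop :=
  (∀ q : List MStep, q <+: p → 0 ≤ mHeight q) ∧ mHeight p = 0

/-- A large (3,2)-Motzkin path: a (3,2)-Motzkin path with no `L3` level step
on the x-axis, i.e. the prefix preceding any `L3` step has positive height. -/
def IsLargeMotzkin32 (p : List MStep) : Prop :=
  IsMotzkin32 p ∧ ∀ a b : List MStep, p = a ++ MStep.L3 :: b → 0 < mHeight a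

/-- `m32 n` is the number of (3,2)-Motzkin paths of length `n`. -/
noncomputable def m32 (n : ℕ) : ℕ :=
  {p : List MStep | p.length = n ∧ IsMotzkin32 p}.ncard

/-- `L32 n` is the number of large (3,2)-Motzkin paths of length `n`. -/
noncomputable def L32 (n : ℕ) : ℕ :=
  {p : List MStep | p.length = n ∧ IsLargeMotzkin32 p}.ncard

/-- An elevated large (3,2)-Motzkin path: a large (3,2)-Motzkin path that
touches the x-axis only at its endpoints. -/
def IsElevatedLargeMotzkin32 (p : List MStep) : Prop :=
  IsLargeMotzkin32 p ∧
    ∀ q : List MStep, q <+: p → q ≠ [] → q ≠ p → 0 < mHeight q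

/-- A linked partition of `{1,…,n}`: blocks are nonempty subsets of
`{1,…,n}` covering it, and any two distinct blocks are nearly disjoint. -/
def IsLinkedPartition (n : ℕ) (π : Finset (Finset ℕ)) : Prop :=
  (∀ B ∈ π, B.Nonempty ∧ B ⊆ Finset.Icc 1 n) ∧
  (∀ i ∈ Finset.Icc 1 n, ∃ B ∈ π, i ∈ B) ∧
  (∀ B ∈ π, ∀ B' ∈ π, B ≠ B' → ∀ k, k ∈ B → k ∈ B' →
    ((∀ j ∈ B, k ≤ j) ∧ 1 < B.card ∧ ¬ (∀ j ∈ B', k ≤ j)) ∨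
    ((∀ j ∈ B', k ≤ j) ∧ 1 < B'.card ∧ ¬ (∀ j ∈ B, k ≤ j)))

/-- Noncrossing condition for a collection of blocks. -/
def IsNoncrossing (π : Finset (Finset ℕ)) : Prop :=
  ¬ ∃ B ∈ π, ∃ B' ∈ π, B ≠ B' ∧
      ∃ i₁ ∈ B, ∃ j₁ ∈ B, ∃ i₂ ∈ B', ∃ j₂ ∈ B',
        i₁ < i₂ ∧ i₂ < j₁ ∧ j₁ < j₂

/-- `ncl n` is the number of noncrossing linked partitions of `{1,…,n}`. -/
noncomputable def ncl (n : ℕ) : ℕ :=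
  {π : Finset (Finset ℕ) | IsLinkedPartition n π ∧ IsNoncrossing π}.ncard

/-- Steps of a Schröder path: up, level (width 2), down. -/
inductive SStep : Type
  | U | L | D
  deriving DecidableEq

/-- Height contribution of a Schröder step. -/
def SStep.height : SStep → ℤ
  | .U => 1
  | .L => 0
  | .D => -1

/-- Width contribution of a Schröder step. -/
def SStep.width : SStep → ℕ
  | .U => 1
  | .L => 2
  | .D => 1

/-- Total height of a list of Schröder steps. -/
def sHeight (p : List SStep) : ℤ := (p.map SStep.height).sum

/-- Total width of a list of Schröder steps. -/
def sWidth (p : List SStep) : ℕ := (p.map SStep.width).sum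

/-- A large Schröder path of length `2n`. -/
def IsLargeSchroeder (n : ℕ) (p : List SStep) : Prop :=
  sWidth p = 2 * n ∧ (∀ q : List SStep, q <+: p → 0 ≤ sHeight q) ∧
    sHeight p = 0

/-- A little Schröder path of length `2n`: a large Schröder path with no
level step on the x-axis. -/
def IsLittleSchroeder (n : ℕ) (p : List SStep) : Prop :=
  IsLargeSchroeder n p ∧ ∀ a b : List SStep, p = a ++ SStep.L :: b → 0 < sHeight a

/-- `SchroederLarge n` is the `n`-th large Schröder number. -/
noncomputable def SchroederLarge (n : ℕ) : ℕ :=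
  {p : List SStep | IsLargeSchroeder n p}.ncard

/-- `SchroederLittle n` is the `n`-th little Schröder number. -/
noncomputable def SchroederLittle (n : ℕ) : ℕ :=
  {p : List SStep | IsLittleSchroeder n p}.ncard

/-! ### Motzkin side -/

/-- Number of completions from height `h` in `n` steps. -/
def gM : ℕ → ℕ → ℕ
  | 0, 0 => 1
  | 0, _ + 1 => 0
  | n + 1, 0 => gM n 1 + 2 * gM n 0
  | n + 1, h + 1 => gM n (h + 2) + 2 * gM n h + 3 * gM n (h + 1)

/-- Completions from height `h`. -/
def Good (h : ℤ) (p : List MStep) : Prop :=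
  ((∀ q : List MStep, q <+: p → 0 ≤ h + mHeight q) ∧ h + mHeight p = 0) ∧
    ∀ a b : List MStep, p = a ++ MStep.L3 :: b → 0 < h + mHeight a

theorem mHeight_nil : mHeight [] = 0 := rfl

theorem mHeight_cons (s : MStep) (p : List MStep) :
    mHeight (s :: p) = s.height + mHeight p := by simp [mHeight]

theorem good_nil (h : ℤ) : Good h [] ↔ h = 0 := by
  constructor
  · rintro ⟨⟨_, h2⟩, _⟩
    simpa [mHeight_nil] using h2
  · rintro rfl
    refine ⟨⟨?_, by simp [mHeight_nil]⟩, ?_⟩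
    · intro q hq
      rw [List.prefix_nil] at hq
      simp [hq, mHeight_nil]
    · intro a b hab
      simp at hab

theorem good_nonneg {h : ℤ} {p : List MStep} (hp : Good h p) : 0 ≤ h := by
  have := hp.1.1 [] List.nil_prefix
  simpa [mHeight_nil] using this

theorem good_cons (h : ℤ) (s : MStep) (p : List MStep) :
    Good h (s :: p) ↔ 0 ≤ h ∧ (s = MStep.L3 → 0 < h) ∧ Good (h + s.height) p := by
  constructor
  · intro H
    refine ⟨good_nonneg H, ?_, ⟨?_, ?_⟩, ?_⟩
    · rintro rfl
      have := H.2 [] p rfl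
      simpa [mHeight_nil] using this
    · intro q hq
      have := H.1.1 (s :: q) (by simpa using hq)
      rw [mHeight_cons] at this
      linarith
    · have := H.1.2
      rw [mHeight_cons] at this
      linarith
    · intro a b hab
      have := H.2 (s :: a) b (by simp [hab])
      rw [mHeight_cons] at this
      linarith
  · rintro ⟨h0, h3, H⟩
    refine ⟨⟨?_, ?_⟩, ?_⟩
    · intro q hq
      cases q with
      | nil => simpa [mHeight_nil] using h0
      | cons t q =>
        rw [List.cons_prefix_cons] at hq
        obtain ⟨rfl, hq⟩ := hq
        have := H.1.1 q hq
        rw [mHeight_cons]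
        linarith
    · have := H.1.2
      rw [mHeight_cons]
      linarith
    · intro a b hab
      cases a with
      | nil =>
        simp at hab
        simpa [mHeight_nil] using h3 hab.1
      | cons t a =>
        simp at hab
        obtain ⟨rfl, hab⟩ := hab
        have := H.2 a b hab
        rw [mHeight_cons]
        linarith

/-- Finset of completions. -/
def PM : ℕ → ℕ → Finset (List MStep)
  | 0, 0 => {[]}
  | 0, _ + 1 => ∅
  | n + 1, 0 => (PM n 1).image (MStep.U :: ·) ∪ ((PM n 0).image (MStep.L1 :: ·) ∪
      (PM n 0).image (MStep.L2 :: ·))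
  | n + 1, h + 1 => (PM n (h + 2)).image (MStep.U :: ·) ∪ ((PM n h).image (MStep.D1 :: ·) ∪
      ((PM n h).image (MStep.D2 :: ·) ∪ ((PM n (h + 1)).image (MStep.L1 :: ·) ∪
      ((PM n (h + 1)).image (MStep.L2 :: ·) ∪ (PM n (h + 1)).image (MStep.L3 :: ·)))))

theorem card_image_cons (S : Finset (List MStep)) (s : MStep) :
    (S.image (s :: ·)).card = S.card :=
  Finset.card_image_of_injective _ (List.cons_injective)

theorem card_PM (n h : ℕ) : (PM n h).card = gM n h := by
  induction n generalizing h with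
  | zero => cases h <;> simp [PM, gM]
  | succ n ih =>
    cases h with
    | zero =>
      rw [PM, gM, Finset.card_union_of_disjoint, Finset.card_union_of_disjoint]
      · simp only [card_image_cons, ih]
        ring
      all_goals
        rw [Finset.disjoint_left]
        intro x
        simp only [Finset.mem_image, Finset.mem_union]
        rintro ⟨a, _, rfl⟩
        simp
    | succ h =>
      rw [PM, gM, Finset.card_union_of_disjoint, Finset.card_union_of_disjoint,
        Finset.card_union_of_disjoint, Finset.card_union_of_disjoint,
        Finset.card_union_of_disjoint]
      · simp only [card_image_cons, ih]
        ring
      all_goals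
        rw [Finset.disjoint_left]
        intro x
        simp only [Finset.mem_image, Finset.mem_union]
        rintro ⟨a, _, rfl⟩
        simp

theorem mem_PM (n h : ℕ) (p : List MStep) : p ∈ PM n h ↔ p.length = n ∧ Good h p := by
  induction n generalizing h p with
  | zero =>
    rw [List.length_eq_zero_iff]
    cases h with
    | zero =>
      simp only [PM, Finset.mem_singleton]
      constructor
      · rintro rfl
        exact ⟨rfl, (good_nil _).2 rfl⟩
      · exact fun h => h.1
    | succ h =>
      simp only [PM, Finset.notMem_empty, false_iff]
      rintro ⟨rfl, h2⟩
      rw [good_nil] at h2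
      omega
  | succ n ih =>
    cases p with
    | nil => cases h <;> simp [PM]
    | cons s p =>
      rw [good_cons]
      cases h with
      | zero =>
        have hn : ¬ Good (-1) p := fun H => by
          have := good_nonneg H
          omega
        simp only [PM, Finset.mem_union, Finset.mem_image, ih]
        cases s <;> simp [MStep.height, hn]
      | succ h =>
        have e1 : ((h + 1 : ℕ) : ℤ) + 1 = ((h + 2 : ℕ) : ℤ) := by push_cast; ring
        have e2 : ((h + 1 : ℕ) : ℤ) + -1 = (h : ℤ) := by push_cast; ring
        have e3 : (0 : ℤ) ≤ ((h + 1 : ℕ) : ℤ) := by omega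
        have e4 : (0 : ℤ) < ((h + 1 : ℕ) : ℤ) := by omega
        simp only [PM, Finset.mem_union, Finset.mem_image, ih]
        cases s <;> simp only [MStep.height, e1, e2, e3, e4, add_zero] <;> simp

theorem L32_eq (n : ℕ) : L32 n = gM n 0 := by
  rw [← card_PM, L32, ← Set.ncard_coe_finset]
  congr 1
  ext p
  simp only [Set.mem_ofPred_eq, Finset.mem_coe, mem_PM]
  simp [Good, IsLargeMotzkin32, IsMotzkin32]

/-! ### The generating tree -/

/-- Number of extensions by `n` elements when `h` elements are visible. -/
def fT : ℕ → ℕ → ℕ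
  | 0, _ => 1
  | n + 1, h => fT n (h + 1) + ∑ j ∈ Finset.range h, fT n (j + 2)

/-- Difference operator. -/
def dl (F : ℕ → ℤ) : ℕ → ℤ := fun h => F (h + 1) - F h

theorem dl_iter_lin (j : ℕ) (F G : ℕ → ℤ) (c : ℤ) :
    dl^[j] (fun h => F h + c * G h) = fun h => dl^[j] F h + c * dl^[j] G h := by
  induction j generalizing F G with
  | zero => rfl
  | succ j ih =>
    simp only [Function.iterate_succ, Function.comp]
    rw [← ih]
    congr 1
    funext h
    simp only [dl]
    ring

theorem fT_diff (n : ℕ) :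
    dl (fun h => (fT (n + 1) (h + 1) : ℤ)) = fun h => ((fT n (h + 1) : ℤ) +
      3 * dl (fun h => (fT n (h + 1) : ℤ)) h) + 2 * dl (dl (fun h => (fT n (h + 1) : ℤ))) h := by
  funext h
  simp only [dl, fT, Finset.sum_range_succ]
  push_cast
  ring

theorem fT_gM (n j : ℕ) :
    2 ^ j * dl^[j] (fun h => (fT n (h + 1) : ℤ)) 0 = gM n j := by
  induction n generalizing j with
  | zero =>
    cases j with
    | zero => simp [fT, gM]
    | succ j =>
      have h0 : dl (fun _ => (1 : ℤ)) = fun _ => 0 := by funext h; simp [dl]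
      have h1 : ∀ j, dl^[j] (fun _ => (0 : ℤ)) = fun _ => 0 := by
        intro j
        induction j with
        | zero => rfl
        | succ j ih =>
          rw [Function.iterate_succ_apply', ih]
          funext h
          simp [dl]
      simp [fT, gM, h0, h1]
  | succ n ih =>
    cases j with
    | zero =>
      have a := ih 0
      have b := ih 1
      simp [dl] at a b
      simp [gM, fT]
      linarith
    | succ j =>
      have a := ih j
      have b := ih (j + 1)
      have c := ih (j + 2)
      rw [Function.iterate_succ_apply, fT_diff, dl_iter_lin, dl_iter_lin]
      simp only [Function.iterate_succ_apply] at a b c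
      simp only [gM]
      push_cast
      rw [← a, ← b, ← c]
      ring

theorem fT_one (n : ℕ) : fT n 1 = gM n 0 := by
  have := fT_gM n 0
  simpa using this

/-! ### Parent functions -/

/-- Noncrossing parent functions on `[m]` (`0` means no parent). -/
def Par (m : ℕ) (p : ℕ → ℕ) : Prop :=
  (∀ k, p k ≠ 0 → p k < k ∧ k ≤ m) ∧
    ∀ k l, ¬ (p k ≠ 0 ∧ p k < p l ∧ p l < k ∧ k < l)

open Classical in
/-- Visible elements. -/
noncomputable def vis (m : ℕ) (p : ℕ → ℕ) : Finset ℕ :=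
  (Finset.Icc 1 m).filter (fun a => ∀ j ∈ Finset.Icc 1 m, ¬ (p j ≠ 0 ∧ p j < a ∧ a < j))

theorem mem_vis {m : ℕ} {p : ℕ → ℕ} {a : ℕ} : a ∈ vis m p ↔ (1 ≤ a ∧ a ≤ m) ∧
    ∀ j, 1 ≤ j → j ≤ m → ¬ (p j ≠ 0 ∧ p j < a ∧ a < j) := by
  simp [vis]

open Classical in
/-- All noncrossing parent functions. -/
noncomputable def VP : ℕ → Finset (ℕ → ℕ)
  | 0 => {fun _ => 0}
  | m + 1 => (VP m).biUnion
      (fun p => (insert 0 (vis m p)).image (fun a => Function.update p (m + 1) a))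

theorem mem_VP (m : ℕ) (p : ℕ → ℕ) : p ∈ VP m ↔ Par m p := by
  induction m generalizing p with
  | zero =>
    simp only [VP, Finset.mem_singleton]
    constructor
    · rintro rfl
      simp [Par]
    · intro h
      funext k
      by_contra hk
      have := h.1 k hk
      omega
  | succ m ih =>
    simp only [VP, Finset.mem_biUnion, Finset.mem_image, ih]
    constructor
    · rintro ⟨p, hp, a, ha, rfl⟩
      have ha' : a = 0 ∨ ((1 ≤ a ∧ a ≤ m) ∧
          ∀ j, 1 ≤ j → j ≤ m → ¬ (p j ≠ 0 ∧ p j < a ∧ a < j)) := by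
        rw [Finset.mem_insert, mem_vis] at ha
        exact ha
      have h1 := hp.1
      have h2 := hp.2
      constructor
      · intro k
        have := h1 k
        by_cases hk : k = m + 1
        · subst hk
          simp
          omega
        · simp [Function.update_of_ne hk]
          omega
      · intro k l
        have hk1 := h1 k
        have hl1 := h1 l
        have h12 := h2 k l
        by_cases hk : k = m + 1
        · by_cases hl : l = m + 1
          · omega
          · rw [Function.update_of_ne hl]
            omega
        · rw [Function.update_of_ne hk]
          by_cases hl : l = m + 1
          · subst hl
            simp only [Function.update_self]
            rintro ⟨c1, c2, c3, c4⟩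
            rcases ha' with h | h
            · omega
            · exact h.2 k (by omega) (by omega) ⟨c1, c2, c3⟩
          · rw [Function.update_of_ne hl]
            exact h12
    · intro hp
      refine ⟨Function.update p (m + 1) 0, ⟨?_, ?_⟩, p (m + 1), ?_, ?_⟩
      · intro k
        have := hp.1 k
        by_cases hk : k = m + 1
        · subst hk
          simp
        · simp [Function.update_of_ne hk]
          omega
      · intro k l
        have := hp.2 k l
        by_cases hk : k = m + 1
        · subst hk
          simp
        · rw [Function.update_of_ne hk]
          by_cases hl : l = m + 1
          · subst hl
            simp
          · rw [Function.update_of_ne hl]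
            exact this
      · rw [Finset.mem_insert, mem_vis]
        by_cases h0 : p (m + 1) = 0
        · exact Or.inl h0
        · have := hp.1 _ h0
          refine Or.inr ⟨by omega, ?_⟩
          intro j hj1 hj2
          rw [Function.update_of_ne (by omega)]
          rintro ⟨c1, c2, c3⟩
          exact hp.2 j (m + 1) ⟨c1, c2, c3, by omega⟩
      · simp

theorem sum_rank (S : Finset ℕ) (F : ℕ → ℕ) :
    ∑ a ∈ S, F (S.filter (· ≤ a)).card = ∑ j ∈ Finset.range S.card, F (j + 1) := by
  induction S using Finset.induction_on_max with
  | empty => simp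
  | insert a S hlt ih =>
    have hn : a ∉ S := fun h => lt_irrefl _ (hlt a h)
    rw [Finset.sum_insert hn, Finset.card_insert_of_notMem hn, Finset.sum_range_succ, ← ih,
      add_comm]
    congr 1
    · apply Finset.sum_congr rfl
      intro x hx
      congr 2
      ext y
      simp only [Finset.mem_filter, Finset.mem_insert]
      have := hlt x hx
      constructor
      · rintro ⟨rfl | h, h2⟩
        · omega
        · exact ⟨h, h2⟩
      · rintro ⟨h, h2⟩
        exact ⟨Or.inr h, h2⟩
    · congr 1
      rw [← Finset.card_insert_of_notMem hn]
      congr 1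
      ext y
      simp only [Finset.mem_filter, Finset.mem_insert]
      constructor
      · exact fun h => h.1
      · intro h
        refine ⟨h, ?_⟩
        rcases h with rfl | h
        · exact le_rfl
        · exact (hlt y h).le

theorem vis_update_zero {m : ℕ} {p : ℕ → ℕ} (hp : Par m p) :
    vis (m + 1) (Function.update p (m + 1) 0) = insert (m + 1) (vis m p) := by
  ext b
  simp only [Finset.mem_insert, mem_vis]
  constructor
  · rintro ⟨h1, h2⟩
    by_cases hb : b = m + 1
    · exact Or.inl hb
    · refine Or.inr ⟨by omega, fun j hj1 hj2 => ?_⟩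
      have := h2 j hj1 (by omega)
      rwa [Function.update_of_ne (by omega)] at this
  · rintro (rfl | ⟨h1, h2⟩)
    · exact ⟨by omega, fun j hj1 hj2 => by omega⟩
    · refine ⟨by omega, fun j hj1 hj2 => ?_⟩
      by_cases hj : j = m + 1
      · subst hj
        simp
      · rw [Function.update_of_ne hj]
        exact h2 j hj1 (by omega)

theorem vis_update {m : ℕ} {p : ℕ → ℕ} (hp : Par m p) {a : ℕ} (ha : a ∈ vis m p) :
    vis (m + 1) (Function.update p (m + 1) a) =
      insert (m + 1) ((vis m p).filter (· ≤ a)) := by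
  rw [mem_vis] at ha
  ext b
  simp only [Finset.mem_insert, mem_vis, Finset.mem_filter]
  constructor
  · rintro ⟨h1, h2⟩
    by_cases hb : b = m + 1
    · exact Or.inl hb
    · refine Or.inr ⟨⟨by omega, fun j hj1 hj2 => ?_⟩, ?_⟩
      · have := h2 j hj1 (by omega)
        rwa [Function.update_of_ne (by omega)] at this
      · have := h2 (m + 1) (by omega) le_rfl
        rw [Function.update_self] at this
        omega
  · rintro (rfl | ⟨⟨h1, h2⟩, h3⟩)
    · exact ⟨by omega, fun j hj1 hj2 => by omega⟩
    · refine ⟨by omega, fun j hj1 hj2 => ?_⟩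
      by_cases hj : j = m + 1
      · subst hj
        simp
        omega
      · rw [Function.update_of_ne hj]
        exact h2 j hj1 (by omega)

theorem notMem_vis (m : ℕ) (p : ℕ → ℕ) : m + 1 ∉ vis m p := by
  rw [mem_vis]
  omega

theorem sum_VP_succ (m : ℕ) (F : ℕ → ℕ) :
    ∑ p ∈ VP (m + 1), F (vis (m + 1) p).card =
      ∑ p ∈ VP m, (F ((vis m p).card + 1) +
        ∑ j ∈ Finset.range (vis m p).card, F (j + 2)) := by
  classical
  have hz : ∀ p ∈ VP m, p (m + 1) = 0 := by
    intro p hp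
    rw [mem_VP] at hp
    by_contra h
    have := hp.1 _ h
    omega
  rw [VP, Finset.sum_biUnion]
  · apply Finset.sum_congr rfl
    intro p hp
    have hP := (mem_VP m p).1 hp
    rw [Finset.sum_image, Finset.sum_insert, vis_update_zero hP,
      Finset.card_insert_of_notMem (notMem_vis m p)]
    · congr 1
      rw [← sum_rank (vis m p) (fun j => F (j + 1))]
      apply Finset.sum_congr rfl
      intro a ha
      rw [vis_update hP ha, Finset.card_insert_of_notMem]
      intro h
      exact notMem_vis m p (Finset.mem_filter.1 h).1
    · rw [mem_vis]
      omega
    · intro a _ b _ hab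
      have := congrFun hab (m + 1)
      simpa using this
  · intro p hp q hq hpq
    rw [Function.onFun, Finset.disjoint_left]
    intro r hr hr'
    rw [Finset.mem_image] at hr hr'
    obtain ⟨a, _, rfl⟩ := hr
    obtain ⟨b, _, hb⟩ := hr'
    apply hpq
    funext k
    by_cases hk : k = m + 1
    · subst hk
      rw [hz p hp, hz q hq]
    · have := congrFun hb k
      simp only [Function.update_of_ne hk] at this
      exact this.symm

theorem card_VP_add (n m : ℕ) : (VP (m + n)).card = ∑ p ∈ VP m, fT n (vis m p).card := by
  induction n generalizing m with
  | zero => simp [fT]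
  | succ n ih =>
    rw [show m + (n + 1) = (m + 1) + n by ring, ih, sum_VP_succ]
    rfl

theorem card_VP (n : ℕ) : (VP (n + 1)).card = fT n 1 := by
  rw [add_comm, card_VP_add, sum_VP_succ 0 (fT n)]
  simp [VP, vis]

/-! ### Linked partitions and parent functions -/

/-- Block with minimum `i`. -/
def blk (m : ℕ) (p : ℕ → ℕ) (i : ℕ) : Finset ℕ :=
  insert i ((Finset.Icc 1 m).filter (fun k => p k = i))

open Classical in
/-- The linked partition of a parent function. -/
noncomputable def PiP (m : ℕ) (p : ℕ → ℕ) : Finset (Finset ℕ) :=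
  ((Finset.Icc 1 m).filter (fun i => p i = 0 ∨ ∃ k ∈ Finset.Icc 1 m, p k = i)).image (blk m p)

theorem mem_blk {m : ℕ} {p : ℕ → ℕ} {i k : ℕ} :
    k ∈ blk m p i ↔ k = i ∨ ((1 ≤ k ∧ k ≤ m) ∧ p k = i) := by
  simp [blk]

theorem mem_PiP {m : ℕ} {p : ℕ → ℕ} {B : Finset ℕ} :
    B ∈ PiP m p ↔ ∃ i, (1 ≤ i ∧ i ≤ m) ∧ (p i = 0 ∨ ∃ k, (1 ≤ k ∧ k ≤ m) ∧ p k = i) ∧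
      blk m p i = B := by
  simp [PiP, and_assoc]

theorem blk_min {m : ℕ} {p : ℕ → ℕ} (hp : Par m p) {i k : ℕ} (hi : 1 ≤ i)
    (hk : k ∈ blk m p i) : i ≤ k ∧ (k ≠ i → i < k ∧ p k = i) := by
  rw [mem_blk] at hk
  have := hp.1 k
  omega

theorem PiP_linked {m : ℕ} {p : ℕ → ℕ} (hp : Par m p) : IsLinkedPartition m (PiP m p) := by
  refine ⟨?_, ?_, ?_⟩
  · intro B hB
    obtain ⟨i, hi, _, rfl⟩ := mem_PiP.1 hB
    refine ⟨⟨i, mem_blk.2 (Or.inl rfl)⟩, ?_⟩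
    intro k hk
    rw [mem_blk] at hk
    rw [Finset.mem_Icc]
    omega
  · intro k hk
    rw [Finset.mem_Icc] at hk
    by_cases h0 : p k = 0
    · exact ⟨blk m p k, mem_PiP.2 ⟨k, hk, Or.inl h0, rfl⟩, mem_blk.2 (Or.inl rfl)⟩
    · have := hp.1 k h0
      exact ⟨blk m p (p k), mem_PiP.2 ⟨p k, by omega, Or.inr ⟨k, hk, rfl⟩, rfl⟩,
        mem_blk.2 (Or.inr ⟨hk, rfl⟩)⟩
  · have key : ∀ i i' k, 1 ≤ i → 1 ≤ i' → i' ≠ i →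
        (p i = 0 ∨ ∃ k, (1 ≤ k ∧ k ≤ m) ∧ p k = i) → k = i → k ∈ blk m p i' →
        ((∀ j ∈ blk m p i, k ≤ j) ∧ 1 < (blk m p i).card ∧
          ¬ (∀ j ∈ blk m p i', k ≤ j)) := by
      rintro i i' k hi hi' hne hc rfl hk'
      have hk2 := (blk_min hp hi' hk').2 (Ne.symm hne)
      refine ⟨fun j hj => (blk_min hp hi hj).1, ?_, ?_⟩
      · rcases hc with h | ⟨c, hc, hcp⟩
        · omega
        · rw [Finset.one_lt_card]
          refine ⟨k, mem_blk.2 (Or.inl rfl), c, mem_blk.2 (Or.inr ⟨hc, hcp⟩), ?_⟩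
          have := hp.1 c
          omega
      · intro h
        have := h i' (mem_blk.2 (Or.inl rfl))
        omega
    intro B hB B' hB' hne k hk hk'
    obtain ⟨i, hi, hc, rfl⟩ := mem_PiP.1 hB
    obtain ⟨i', hi', hc', rfl⟩ := mem_PiP.1 hB'
    have hii : i ≠ i' := fun h => hne (by rw [h])
    by_cases h1 : k = i
    · exact Or.inl (key i i' k hi.1 hi'.1 (Ne.symm hii) hc h1 hk')
    · by_cases h2 : k = i'
      · exact Or.inr (key i' i k hi'.1 hi.1 hii hc' h2 hk)
      · have a := ((blk_min hp hi.1 hk).2 h1).2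
        have b := ((blk_min hp hi'.1 hk').2 h2).2
        omega

theorem PiP_nc {m : ℕ} {p : ℕ → ℕ} (hp : Par m p) : IsNoncrossing (PiP m p) := by
  rintro ⟨B, hB, B', hB', hne, i₁, hi₁, j₁, hj₁, i₂, hi₂, j₂, hj₂, h1, h2, h3⟩
  obtain ⟨i, hi, hc, rfl⟩ := mem_PiP.1 hB
  obtain ⟨i', hi', hc', rfl⟩ := mem_PiP.1 hB'
  have hii : i ≠ i' := fun h => hne (by rw [h])
  have a1 := blk_min hp hi.1 hi₁
  have a2 := blk_min hp hi.1 hj₁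
  have a3 := blk_min hp hi'.1 hi₂
  have a4 := blk_min hp hi'.1 hj₂
  have b1 := hp.2 j₁ j₂
  have b2 := hp.2 i₂ j₁
  omega

theorem PiP_par {m : ℕ} {p : ℕ → ℕ} (hp : Par m p) (k i : ℕ) (hi : i ≠ 0) :
    p k = i ↔ ∃ B ∈ PiP m p, k ∈ B ∧ i ∈ B ∧ (∀ j ∈ B, i ≤ j) ∧ i < k := by
  constructor
  · rintro rfl
    have := hp.1 k hi
    have hk : 1 ≤ k ∧ k ≤ m := by omega
    exact ⟨blk m p (p k), mem_PiP.2 ⟨p k, by omega, Or.inr ⟨k, hk, rfl⟩, rfl⟩,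
      mem_blk.2 (Or.inr ⟨hk, rfl⟩), mem_blk.2 (Or.inl rfl),
      fun j hj => (blk_min hp (by omega) hj).1, this.1⟩
  · rintro ⟨B, hB, hk, hiB, hmin, hlt⟩
    obtain ⟨i', hi', hc, rfl⟩ := mem_PiP.1 hB
    have a := hmin i' (mem_blk.2 (Or.inl rfl))
    have b := blk_min hp hi'.1 hiB
    have c := blk_min hp hi'.1 hk
    omega

theorem PiP_inj {m : ℕ} {p q : ℕ → ℕ} (hp : Par m p) (hq : Par m q)
    (h : PiP m p = PiP m q) : p = q := by
  have key : ∀ k i, i ≠ 0 → (p k = i ↔ q k = i) := by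
    intro k i hi
    rw [PiP_par hp k i hi, PiP_par hq k i hi, h]
  funext k
  by_cases h0 : p k = 0
  · by_cases h1 : q k = 0
    · rw [h0, h1]
    · exact (key k (q k) h1).2 rfl
  · exact ((key k (p k) h0).1 rfl).symm

theorem PiP_surj {m : ℕ} {π : Finset (Finset ℕ)} (hL : IsLinkedPartition m π)
    (hN : IsNoncrossing π) : ∃ p, Par m p ∧ PiP m p = π := by
  classical
  obtain ⟨h1, h2, h3⟩ := hL
  -- relation
  let R : ℕ → ℕ → Prop := fun k i => ∃ B ∈ π, k ∈ B ∧ i ∈ B ∧ (∀ j ∈ B, i ≤ j) ∧ i < k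
  have hpos : ∀ B ∈ π, ∀ k ∈ B, 1 ≤ k ∧ k ≤ m := by
    intro B hB k hk
    simpa using (h1 B hB).2 hk
  have hmin : ∀ B ∈ π, ∃ i ∈ B, ∀ j ∈ B, i ≤ j := by
    intro B hB
    exact ⟨B.min' (h1 B hB).1, Finset.min'_mem _ _, fun j hj => Finset.min'_le _ _ hj⟩
  -- two blocks in which `k` is not minimal coincide
  have uni : ∀ B ∈ π, ∀ B' ∈ π, ∀ k ∈ B, k ∈ B' → (∃ i ∈ B, i < k) → (∃ i ∈ B', i < k) →
      B = B' := by
    rintro B hB B' hB' k hk hk' ⟨i, hi, hik⟩ ⟨i', hi', hik'⟩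
    by_contra hne
    rcases h3 B hB B' hB' hne k hk hk' with ⟨h, _⟩ | ⟨h, _⟩
    · have := h i hi
      omega
    · have := h i' hi'
      omega
  -- two blocks with the same minimum coincide
  have unim : ∀ B ∈ π, ∀ B' ∈ π, ∀ k ∈ B, k ∈ B' → (∀ i ∈ B, k ≤ i) → (∀ i ∈ B', k ≤ i) →
      B = B' := by
    intro B hB B' hB' k hk hk' hm hm'
    by_contra hne
    rcases h3 B hB B' hB' hne k hk hk' with ⟨_, _, h⟩ | ⟨_, _, h⟩
    · exact h hm'
    · exact h hm
  have hRu : ∀ k i i', R k i → R k i' → i = i' := by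
    rintro k i i' ⟨B, hB, hk, hi, hm, hlt⟩ ⟨B', hB', hk', hi', hm', hlt'⟩
    have := uni B hB B' hB' k hk hk' ⟨i, hi, hlt⟩ ⟨i', hi', hlt'⟩
    subst this
    exact le_antisymm (hm _ hi') (hm' _ hi)
  let p : ℕ → ℕ := fun k => if h : ∃ i, R k i then h.choose else 0
  have hpR : ∀ k i, R k i → p k = i := by
    intro k i h
    have hex : ∃ i, R k i := ⟨i, h⟩
    have : p k = hex.choose := dif_pos hex
    rw [this]
    exact hRu k _ _ hex.choose_spec h
  have hRp : ∀ k, p k ≠ 0 → R k (p k) := by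
    intro k h
    by_cases hex : ∃ i, R k i
    · have : p k = hex.choose := dif_pos hex
      rw [this]
      exact hex.choose_spec
    · exact absurd (dif_neg hex) h
  have hP : Par m p := by
    refine ⟨?_, ?_⟩
    · intro k hk
      obtain ⟨B, hB, hkB, _, _, hlt⟩ := hRp k hk
      exact ⟨hlt, (hpos B hB k hkB).2⟩
    · rintro k l ⟨c1, c2, c3, c4⟩
      obtain ⟨B, hB, hkB, hi, hm, hlt⟩ := hRp k c1
      obtain ⟨B', hB', hkB', hi', hm', hlt'⟩ := hRp l (by omega)
      apply hN
      refine ⟨B, hB, B', hB', ?_, p k, hi, k, hkB, p l, hi', l, hkB', c2, c3, c4⟩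
      rintro rfl
      have := hm' _ hi
      omega
  -- a block is determined by its minimum
  have hblk : ∀ B ∈ π, ∀ i ∈ B, (∀ j ∈ B, i ≤ j) → blk m p i = B := by
    intro B hB i hi hm
    ext k
    rw [mem_blk]
    constructor
    · rintro (rfl | ⟨hk, hpk⟩)
      · exact hi
      · have hi1 := hpos B hB i hi
        obtain ⟨B', hB', hkB', hi', hm', hlt'⟩ := hRp k (by omega)
        rw [hpk] at hi' hm'
        rw [unim B hB B' hB' i hi hi' hm hm']
        exact hkB'
    · intro hk
      by_cases hki : k = i
      · exact Or.inl hki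
      · refine Or.inr ⟨hpos B hB k hk, hpR k i ⟨B, hB, hk, hi, hm, ?_⟩⟩
        have := hm k hk
        omega
  refine ⟨p, hP, ?_⟩
  ext B
  rw [mem_PiP]
  constructor
  · rintro ⟨i, hi, hc, rfl⟩
    rcases hc with h0 | ⟨k, hk, hpk⟩
    · obtain ⟨B, hB, hiB⟩ := h2 i (Finset.mem_Icc.2 hi)
      rw [hblk B hB i hiB]
      · exact hB
      · intro j hj
        by_contra hlt
        obtain ⟨i0, hi0, hm0⟩ := hmin B hB
        have e1 := hm0 j hj
        have := hpR i i0 ⟨B, hB, hiB, hi0, hm0, by omega⟩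
        have := hpos B hB i0 hi0
        omega
    · obtain ⟨B, hB, hkB, hiB, hm, _⟩ := hRp k (by omega)
      rw [hpk] at hiB hm
      rw [hblk B hB i hiB hm]
      exact hB
  · intro hB
    obtain ⟨i, hi, hm⟩ := hmin B hB
    refine ⟨i, hpos B hB i hi, ?_, hblk B hB i hi hm⟩
    by_cases h0 : p i = 0
    · exact Or.inl h0
    · right
      obtain ⟨B', hB', hiB', hjB', hm', hlt'⟩ := hRp i h0
      have hne : B ≠ B' := by
        rintro rfl
        have := hm _ hjB'
        omega
      have hcard : 1 < B.card := by
        rcases h3 B hB B' hB' hne i hi hiB' with ⟨_, h, _⟩ | ⟨h, _, _⟩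
        · exact h
        · have := h _ hjB'
          omega
      obtain ⟨k, hk, hki⟩ := Finset.exists_mem_ne hcard i
      refine ⟨k, hpos B hB k hk, hpR k i ⟨B, hB, hk, hi, hm, ?_⟩⟩
      have := hm k hk
      omega

theorem ncl_eq_card (m : ℕ) : ncl m = (VP m).card := by
  have hset : {π : Finset (Finset ℕ) | IsLinkedPartition m π ∧ IsNoncrossing π} =
      Set.image (PiP m) (VP m : Set (ℕ → ℕ)) := by
    ext π
    simp only [Set.mem_ofPred_eq, Set.mem_image, Finset.mem_coe, mem_VP]
    constructor
    · rintro ⟨hL, hN⟩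
      exact PiP_surj hL hN
    · rintro ⟨p, hp, rfl⟩
      exact ⟨PiP_linked hp, PiP_nc hp⟩
  rw [ncl, hset, Set.InjOn.ncard_image, Set.ncard_coe_finset]
  intro p hp q hq h
  rw [Finset.mem_coe, mem_VP] at hp hq
  exact PiP_inj hp hq h

/-- The number of noncrossing linked partitions of `{1,…,n+1}` equals the
number of large (3,2)-Motzkin paths of length `n`. -/
theorem ncl_eq_large_motzkin32 (n : ℕ) : ncl (n + 1) = L32 n := by
  rw [ncl_eq_card, card_VP, fT_one, L32_eq]
end

section
/- Let f_n denote the number of noncrossing linked partitions of [n]. Then f_1 = 1 and, for every integer n ≥ 1, f_{n+1} = f_n + ∑_{i=1}^{n} f_i · f_{n+1−i}. (This is the coefficient form of Dykema's generating function identity F(x) = ∑_{n≥0} f_{n+1} x^n = (1 − x − √(1 − 6x + x²))/(2x), which is equivalent to the algebraic equation F = 1 + xF + xF².) -/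
/-- Parent functions encoding noncrossing linked partitions of `{1,…,n}`
(value `0` means no parent). -/
def NCPar (n : ℕ) : Set (ℕ → ℕ) :=
  {p | (∀ k, k = 0 ∨ n < k → p k = 0) ∧ (∀ k, 1 ≤ k → p k < k) ∧
    ∀ a b, 0 < p a → p a < p b → p b < a → a < b → False}

lemma NCPar_nc {n : ℕ} {p : ℕ → ℕ} (hp : p ∈ NCPar n) (a b : ℕ) :
    ¬ (0 < p a ∧ p a < p b ∧ p b < a ∧ a < b) :=
  fun h => hp.2.2 a b h.1 h.2.1 h.2.2.1 h.2.2.2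

lemma NCPar_finite (n : ℕ) : (NCPar n).Finite := by
  have hinj : Set.InjOn (fun (p : ℕ → ℕ) (k : Fin (n+1)) => p k) (NCPar n) := by
    intro p hp q hq h
    funext k
    by_cases hk : k ≤ n
    · exact congrFun h ⟨k, by omega⟩
    · rw [hp.1 k (by omega), hq.1 k (by omega)]
  refine Set.Finite.of_finite_image ?_ hinj
  refine Set.Finite.subset (Set.Finite.pi' (t := fun _ : Fin (n+1) => Set.Iic n)
    (fun _ => Set.finite_Iic n)) ?_
  rintro _ ⟨p, hp, rfl⟩ k
  have := hp.2.1 k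
  have := hp.1 k
  have := k.2
  simp only [Set.mem_Iic]
  by_cases h : (k : ℕ) = 0
  · have := hp.1 k (Or.inl h); omega
  · have := hp.2.1 k (by omega); omega

/-- Gluing. -/
def nclGlue (n m : ℕ) (x : (ℕ → ℕ) × (ℕ → ℕ)) : ℕ → ℕ := fun k =>
  if k ≤ m then x.1 k else if k ≤ n then
    (if x.2 (k + 1 - m) = 0 then 0 else x.2 (k + 1 - m) + m - 1)
  else if k = n + 1 then m else 0

/-- Splitting. -/
def nclSplit (n m : ℕ) (p : ℕ → ℕ) : (ℕ → ℕ) × (ℕ → ℕ) :=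
  (fun k => if k ≤ m then p k else 0,
   fun k => if 2 ≤ k ∧ k ≤ n + 1 - m then p (k + m - 1) - (m - 1) else 0)

lemma nclSplit_mem (n m : ℕ) (hm : 1 ≤ m) (hmn : m ≤ n) (p : ℕ → ℕ)
    (hp : p ∈ NCPar (n+1)) (hpm : p (n+1) = m) :
    nclSplit n m p ∈ NCPar m ×ˢ NCPar (n + 1 - m) := by
  have h4 := NCPar_nc hp
  obtain ⟨h1, h2, h3⟩ := hp
  refine ⟨⟨?_, ?_, ?_⟩, ?_, ?_, ?_⟩ <;> simp only [nclSplit]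
  · grind
  · grind
  · grind
  · grind
  · intro k hk
    have := h2 (k + m - 1) (by omega)
    split_ifs <;> omega
  · intro a b
    have := h4 (a+m-1) (b+m-1)
    have := h4 (a+m-1) (n+1)
    split_ifs <;> omega

lemma nclGlue_mem (n m : ℕ) (hm : 1 ≤ m) (hmn : m ≤ n) (x : (ℕ → ℕ) × (ℕ → ℕ))
    (hx : x ∈ NCPar m ×ˢ NCPar (n + 1 - m)) :
    nclGlue n m x ∈ NCPar (n+1) ∧ nclGlue n m x (n+1) = m := by
  obtain ⟨q, r⟩ := x
  have h4 := NCPar_nc hx.1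
  have g4 := NCPar_nc hx.2
  obtain ⟨⟨h1, h2, h3⟩, g1, g2, g3⟩ := hx
  simp only at h1 h2 h3 g1 g2 g3 h4 g4
  refine ⟨⟨?_, ?_, ?_⟩, ?_⟩ <;> simp only [nclGlue]
  · intro k hk
    have := h1 k
    split_ifs <;> omega
  · intro k hk
    have := h2 k hk
    have := g2 (k + 1 - m)
    split_ifs <;> omega
  · intro a b
    have := h4 a b
    have := g4 (a+1-m) (b+1-m)
    have := h2 a
    have := h1 a
    have := g2 (a+1-m)
    have := g2 (b+1-m)
    split_ifs <;> omega
  · grind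

lemma nclSplit_glue (n m : ℕ) (hm : 1 ≤ m) (hmn : m ≤ n) (x : (ℕ → ℕ) × (ℕ → ℕ))
    (hx : x ∈ NCPar m ×ˢ NCPar (n + 1 - m)) :
    nclSplit n m (nclGlue n m x) = x := by
  obtain ⟨q, r⟩ := x
  obtain ⟨⟨h1, h2, h3⟩, g1, g2, g3⟩ := hx
  simp only at h1 h2 h3 g1 g2 g3
  simp only [nclSplit, nclGlue, Prod.mk.injEq]
  constructor <;> funext k
  · grind
  · have e : 1 ≤ k → k + m - 1 + 1 - m = k := by omega
    by_cases hk : 2 ≤ k ∧ k ≤ n + 1 - m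
    · rw [e (by omega)]
      split_ifs <;> omega
    · have := g1 k
      have := g2 k
      split_ifs; omega

lemma nclGlue_split (n m : ℕ) (hm : 1 ≤ m) (hmn : m ≤ n) (p : ℕ → ℕ)
    (hp : p ∈ NCPar (n+1)) (hpm : p (n+1) = m) :
    nclGlue n m (nclSplit n m p) = p := by
  have h4 := NCPar_nc hp
  obtain ⟨h1, h2, h3⟩ := hp
  funext k
  simp only [nclSplit, nclGlue]
  have := h1 k
  have := h2 k
  have := h4 k (n+1)
  by_cases hk : k ≤ m
  · simp [hk]
  · simp only [show k + 1 - m + m - 1 = k by omega]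
    by_cases hk' : k = n+1
    · subst hk'
      split_ifs <;> omega
    · split_ifs <;> omega

lemma NCPar_fiber (n m : ℕ) (hm : 1 ≤ m) (hmn : m ≤ n) :
    {p ∈ NCPar (n+1) | p (n+1) = m}.ncard = (NCPar m).ncard * (NCPar (n+1-m)).ncard := by
  rw [← Set.ncard_prod]
  refine Set.ncard_congr (fun p _ => nclSplit n m p) ?_ ?_ ?_
  · rintro p ⟨hp, h⟩
    exact nclSplit_mem n m hm hmn p hp h
  · rintro p q ⟨hp, h⟩ ⟨hq, h'⟩ e
    rw [← nclGlue_split n m hm hmn p hp h, ← nclGlue_split n m hm hmn q hq h', e]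
  · intro x hx
    exact ⟨nclGlue n m x, nclGlue_mem n m hm hmn x hx, nclSplit_glue n m hm hmn x hx⟩

lemma NCPar_fiber_zero (n : ℕ) :
    {p ∈ NCPar (n+1) | p (n+1) = 0} = NCPar n := by
  ext p
  constructor
  · rintro ⟨⟨h1, h2, h3⟩, h⟩
    refine ⟨?_, h2, h3⟩
    intro k hk
    by_cases hk' : k = n+1
    · rw [hk', h]
    · exact h1 k (by omega)
  · rintro ⟨h1, h2, h3⟩
    exact ⟨⟨fun k hk => h1 k (by omega), h2, h3⟩, h1 _ (by omega)⟩

lemma NCPar_rec (n : ℕ) :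
    (NCPar (n+1)).ncard = (NCPar n).ncard +
      ∑ i ∈ Finset.Icc 1 n, (NCPar i).ncard * (NCPar (n+1-i)).ncard := by
  classical
  have key : (NCPar (n+1)).ncard =
      ∑ i ∈ Finset.range (n+1), {p ∈ NCPar (n+1) | p (n+1) = i}.ncard := by
    rw [Set.ncard_eq_toFinset_card _ (NCPar_finite (n+1)),
      Finset.card_eq_sum_card_fiberwise (f := fun p : ℕ → ℕ => p (n+1))
        (t := Finset.range (n+1))]
    · refine Finset.sum_congr rfl fun i _ => ?_
      rw [← Set.ncard_coe_finset]
      congr 1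
      ext p
      simp
    · intro p hp
      have hp' : p ∈ NCPar (n+1) := by simpa using hp
      have := hp'.2.1 (n+1) (by omega)
      simpa using this
  rw [key, Finset.range_eq_Ico, Finset.sum_eq_sum_Ico_succ_bot (by omega), NCPar_fiber_zero]
  congr 1
  refine Finset.sum_congr (by ext; simp) fun i hi => ?_
  have := Finset.mem_Icc.1 hi
  exact NCPar_fiber n i this.1 this.2

/-- Block with minimum `i`. -/
def nclBlk (n : ℕ) (p : ℕ → ℕ) (i : ℕ) : Finset ℕ :=
  insert i ((Finset.Icc 1 n).filter (fun k => p k = i))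

open Classical in
/-- Linked partition of a parent function. -/
noncomputable def nclOf (n : ℕ) (p : ℕ → ℕ) : Finset (Finset ℕ) :=
  ((Finset.Icc 1 n).filter (fun i => p i = 0 ∨ ∃ k ∈ Finset.Icc 1 n, p k = i)).image (nclBlk n p)

lemma mem_nclBlk {n : ℕ} {p : ℕ → ℕ} {i k : ℕ} :
    k ∈ nclBlk n p i ↔ k = i ∨ ((1 ≤ k ∧ k ≤ n) ∧ p k = i) := by
  simp [nclBlk]

lemma mem_nclOf {n : ℕ} {p : ℕ → ℕ} {B : Finset ℕ} :
    B ∈ nclOf n p ↔ ∃ i, (1 ≤ i ∧ i ≤ n) ∧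
      (p i = 0 ∨ ∃ k, (1 ≤ k ∧ k ≤ n) ∧ p k = i) ∧ nclBlk n p i = B := by
  simp [nclOf, and_assoc]

lemma nclBlk_min {n : ℕ} {p : ℕ → ℕ} (hp : p ∈ NCPar n) {i k : ℕ} (h : k ∈ nclBlk n p i) :
    i ≤ k := by
  rcases mem_nclBlk.1 h with h | ⟨h, e⟩
  · exact h.ge
  · have := hp.2.1 k h.1
    omega

lemma nclOf_linked (n : ℕ) (p : ℕ → ℕ) (hp : p ∈ NCPar n) : IsLinkedPartition n (nclOf n p) := by
  refine ⟨?_, ?_, ?_⟩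
  · intro B hB
    obtain ⟨i, hi, h, rfl⟩ := mem_nclOf.1 hB
    refine ⟨⟨i, mem_nclBlk.2 (Or.inl rfl)⟩, fun k hk => ?_⟩
    rw [Finset.mem_Icc]
    rcases mem_nclBlk.1 hk with h | h
    · omega
    · exact h.1
  · intro i hi
    rw [Finset.mem_Icc] at hi
    by_cases h : p i = 0
    · exact ⟨_, mem_nclOf.2 ⟨i, hi, Or.inl h, rfl⟩, mem_nclBlk.2 (Or.inl rfl)⟩
    · have := hp.2.1 i hi.1
      exact ⟨_, mem_nclOf.2 ⟨p i, by omega, Or.inr ⟨i, hi, rfl⟩, rfl⟩,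
        mem_nclBlk.2 (Or.inr ⟨hi, rfl⟩)⟩
  · intro B hB B' hB' hne k hk hk'
    obtain ⟨i, hi, h, rfl⟩ := mem_nclOf.1 hB
    obtain ⟨i', hi', h', rfl⟩ := mem_nclOf.1 hB'
    have hii : i ≠ i' := fun e => hne (by rw [e])
    have aux : ∀ i i', (p i = 0 ∨ ∃ k, (1 ≤ k ∧ k ≤ n) ∧ p k = i) → 1 ≤ i' → i ≠ i' → p i = i' →
        ((∀ j ∈ nclBlk n p i, i ≤ j) ∧ 1 < (nclBlk n p i).card ∧
          ¬ (∀ j ∈ nclBlk n p i', i ≤ j)) := by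
      intro i i' h hi' hii e
      refine ⟨fun j hj => nclBlk_min hp hj, ?_, ?_⟩
      · rcases h with h | ⟨k, hk, hki⟩
        · omega
        · refine Finset.one_lt_card.2 ⟨i, mem_nclBlk.2 (Or.inl rfl), k,
            mem_nclBlk.2 (Or.inr ⟨hk, hki⟩), ?_⟩
          have := hp.2.1 k hk.1
          omega
      · intro hh
        have h1 := hh i' (mem_nclBlk.2 (Or.inl rfl))
        have h2 := hp.2.1 i
        have h3 := hp.1 i
        omega
    rcases mem_nclBlk.1 hk with e | e <;> rcases mem_nclBlk.1 hk' with e' | e'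
    · omega
    · subst e
      exact Or.inl (aux k i' h hi'.1 hii e'.2)
    · subst e'
      exact Or.inr (aux k i h' hi.1 hii.symm e.2)
    · omega

lemma nclOf_nc (n : ℕ) (p : ℕ → ℕ) (hp : p ∈ NCPar n) : IsNoncrossing (nclOf n p) := by
  rintro ⟨B, hB, B', hB', hne, i₁, hi₁, j₁, hj₁, i₂, hi₂, j₂, hj₂, h12, h21, hj⟩
  obtain ⟨i, hi, h, rfl⟩ := mem_nclOf.1 hB
  obtain ⟨i', hi', h', rfl⟩ := mem_nclOf.1 hB'
  have hii : i ≠ i' := fun e => hne (by rw [e])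
  have a1 := nclBlk_min hp hi₁
  have a2 := nclBlk_min hp hi₂
  rw [mem_nclBlk] at hi₁ hj₁ hi₂ hj₂
  have := NCPar_nc hp j₁ j₂
  have := NCPar_nc hp i₂ j₁
  clear h h'
  omega

lemma nclOf_parent (n : ℕ) (p : ℕ → ℕ) (hp : p ∈ NCPar n) (k i : ℕ) (hi : i ≠ 0) :
    p k = i ↔ ∃ B ∈ nclOf n p, k ∈ B ∧ i ∈ B ∧ i < k ∧ ∀ j ∈ B, i ≤ j := by
  have h1 := hp.1 k
  have h2 := hp.2.1 k
  constructor
  · intro e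
    exact ⟨nclBlk n p i, mem_nclOf.2 ⟨i, by omega, Or.inr ⟨k, by omega, e⟩, rfl⟩,
      mem_nclBlk.2 (Or.inr (by omega)), mem_nclBlk.2 (Or.inl rfl), by omega,
      fun j hj => nclBlk_min hp hj⟩
  · rintro ⟨B, hB, hk, hiB, hik, hmin⟩
    obtain ⟨i', hi', h, rfl⟩ := mem_nclOf.1 hB
    have a := hmin i' (mem_nclBlk.2 (Or.inl rfl))
    have b := nclBlk_min hp hiB
    rw [mem_nclBlk] at hk
    omega

lemma nclOf_inj (n : ℕ) : Set.InjOn (nclOf n) (NCPar n) := by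
  intro p hp q hq h
  have key : ∀ k i, i ≠ 0 → (p k = i ↔ q k = i) := fun k i hi => by
    rw [nclOf_parent n p hp k i hi, nclOf_parent n q hq k i hi, h]
  funext k
  have h1 := key k (p k)
  have h2 := key k (q k)
  by_cases hpk : p k = 0
  · by_cases hqk : q k = 0
    · omega
    · exact (h2 hqk).2 rfl
  · exact ((h1 hpk).1 rfl).symm

lemma nclOf_surj (n : ℕ) (π : Finset (Finset ℕ)) (hl : IsLinkedPartition n π)
    (hc : IsNoncrossing π) : ∃ p ∈ NCPar n, nclOf n p = π := by
  classical
  obtain ⟨l1, l2, l3⟩ := hl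
  let R : ℕ → ℕ → Prop := fun k i => ∃ B ∈ π, k ∈ B ∧ i ∈ B ∧ i < k ∧ ∀ j ∈ B, i ≤ j
  let p : ℕ → ℕ := fun k => if h : ∃ i, R k i then h.choose else 0
  have hR1 : ∀ k i, R k i → 1 ≤ i ∧ i < k ∧ k ≤ n := by
    rintro k i ⟨B, hB, hk, hi, hik, -⟩
    have a := Finset.mem_Icc.1 ((l1 B hB).2 hk)
    have b := Finset.mem_Icc.1 ((l1 B hB).2 hi)
    omega
  -- uniqueness of the block in which an element is not minimal
  have huniq : ∀ k B B', B ∈ π → B' ∈ π → k ∈ B → k ∈ B' → (∃ i ∈ B, i < k) →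
      (∃ i ∈ B', i < k) → B = B' := by
    rintro k B B' hB hB' hk hk' ⟨i, hi, hik⟩ ⟨i', hi', hik'⟩
    by_contra hne
    rcases l3 B hB B' hB' hne k hk hk' with h | h
    · have := h.1 i hi; omega
    · have := h.1 i' hi'; omega
  -- uniqueness of the block with a given minimum
  have huniq2 : ∀ i B B', B ∈ π → B' ∈ π → i ∈ B → i ∈ B' → (∀ j ∈ B, i ≤ j) →
      (∀ j ∈ B', i ≤ j) → B = B' := by
    intro i B B' hB hB' hk hk' h h'
    by_contra hne
    rcases l3 B hB B' hB' hne i hk hk' with g | g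
    · exact g.2.2 h'
    · exact g.2.2 h
  have hR2 : ∀ k i i', R k i → R k i' → i = i' := by
    rintro k i i' ⟨B, hB, hk, hi, hik, hm⟩ ⟨B', hB', hk', hi', hik', hm'⟩
    obtain rfl := huniq k B B' hB hB' hk hk' ⟨i, hi, hik⟩ ⟨i', hi', hik'⟩
    exact le_antisymm (hm _ hi') (hm' _ hi)
  have hpR : ∀ k i, i ≠ 0 → (p k = i ↔ R k i) := by
    intro k i hi
    by_cases h : ∃ i, R k i
    · have e : p k = h.choose := dif_pos h
      constructor
      · intro e'
        rw [← e', e]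
        exact h.choose_spec
      · intro h'
        rw [e]
        exact hR2 k _ _ h.choose_spec h'
    · have e : p k = 0 := dif_neg h
      constructor
      · omega
      · intro h'
        exact absurd ⟨i, h'⟩ h
  have hp0 : ∀ k, p k ≠ 0 → R k (p k) := fun k hk => (hpR k _ hk).1 rfl
  have hp : p ∈ NCPar n := by
    refine ⟨?_, ?_, ?_⟩
    · intro k hk
      by_contra h
      have := hR1 k _ (hp0 k h)
      omega
    · intro k hk
      by_cases h : p k = 0
      · omega
      · exact (hR1 k _ (hp0 k h)).2.1
    · intro a b h1 h2 h3 h4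
      obtain ⟨B, hB, hk, hi, hik, hm⟩ := hp0 a (by omega)
      obtain ⟨B', hB', hk', hi', hik', hm'⟩ := hp0 b (by omega)
      refine hc ⟨B, hB, B', hB', ?_, p a, hi, a, hk, p b, hi', b, hk', h2, h3, h4⟩
      rintro rfl
      have := hm' _ hi
      omega
  -- blocks are determined by their minimum
  have hblk : ∀ B ∈ π, ∀ i ∈ B, (∀ j ∈ B, i ≤ j) → nclBlk n p i = B := by
    intro B hB i hi hm
    have hi1 := Finset.mem_Icc.1 ((l1 B hB).2 hi)
    ext k
    rw [mem_nclBlk]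
    constructor
    · rintro (rfl | ⟨hk, e⟩)
      · exact hi
      · obtain ⟨B', hB', hk', hi', hik', hm'⟩ := (hpR k i (by omega)).1 e
        rw [huniq2 i B B' hB hB' hi hi' hm hm']
        exact hk'
    · intro hk
      have hk1 := Finset.mem_Icc.1 ((l1 B hB).2 hk)
      rcases (hm k hk).eq_or_lt with e | e
      · exact Or.inl e.symm
      · exact Or.inr ⟨hk1, (hpR k i (by omega)).2 ⟨B, hB, hk, hi, e, hm⟩⟩
  refine ⟨p, hp, ?_⟩
  ext B
  rw [mem_nclOf]
  constructor
  · rintro ⟨i, hi, h, rfl⟩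
    have : ∃ B ∈ π, i ∈ B ∧ ∀ j ∈ B, i ≤ j := by
      rcases h with h | ⟨k, hk, h⟩
      · obtain ⟨B, hB, hiB⟩ := l2 i (Finset.mem_Icc.2 hi)
        refine ⟨B, hB, hiB, ?_⟩
        by_contra hcon
        push Not at hcon
        obtain ⟨j, hj, hji⟩ := hcon
        have hne : B.Nonempty := ⟨i, hiB⟩
        have hmin := Finset.min'_le B j hj
        have hmm := Finset.mem_Icc.1 ((l1 B hB).2 (B.min'_mem hne))
        have := (hpR i (B.min' hne) (by omega)).2
          ⟨B, hB, hiB, B.min'_mem hne, by omega, fun j hj => Finset.min'_le B j hj⟩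
        omega
      · obtain ⟨B, hB, -, hiB, -, hm⟩ := (hpR k i (by omega)).1 h
        exact ⟨B, hB, hiB, hm⟩
    obtain ⟨B, hB, hiB, hm⟩ := this
    rw [hblk B hB i hiB hm]
    exact hB
  · intro hB
    have hne := (l1 B hB).1
    have hmB := B.min'_mem hne
    have hm : ∀ j ∈ B, B.min' hne ≤ j := fun j hj => Finset.min'_le B j hj
    generalize B.min' hne = i at hmB hm
    have hi := Finset.mem_Icc.1 ((l1 B hB).2 hmB)
    refine ⟨i, hi, ?_, hblk B hB i hmB hm⟩
    by_contra hcon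
    push Not at hcon
    obtain ⟨hpi, hch⟩ := hcon
    have hsing : ∀ k ∈ B, k = i := by
      intro k hk
      by_contra hki
      have := hm k hk
      exact hch k (Finset.mem_Icc.1 ((l1 B hB).2 hk))
        ((hpR k i (by omega)).2 ⟨B, hB, hk, hmB, by omega, hm⟩)
    obtain ⟨B', hB', hiB', hiB'', hlt, hm'⟩ := hp0 i hpi
    have hBB : B ≠ B' := by
      rintro rfl
      have := hsing _ hiB''
      omega
    rcases l3 B hB B' hB' hBB i hmB hiB' with h | h
    · obtain ⟨x, hx, y, hy, hxy⟩ := Finset.one_lt_card.1 h.2.1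
      exact hxy ((hsing x hx).trans (hsing y hy).symm)
    · have := h.1 _ hiB''
      omega

lemma ncl_eq (n : ℕ) : ncl n = (NCPar n).ncard := by
  symm
  refine Set.ncard_congr (fun p _ => nclOf n p) ?_ ?_ ?_
  · intro p hp
    exact ⟨nclOf_linked n p hp, nclOf_nc n p hp⟩
  · intro p q hp hq h
    exact nclOf_inj n hp hq h
  · rintro π ⟨h1, h2⟩
    obtain ⟨p, hp, e⟩ := nclOf_surj n π h1 h2
    exact ⟨p, hp, e⟩

lemma NCPar_zero : (NCPar 0).ncard = 1 := by
  rw [Set.ncard_eq_one]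
  refine ⟨fun _ => 0, ?_⟩
  ext p
  constructor
  · rintro ⟨h1, -, -⟩
    funext k
    exact h1 k (by omega)
  · rintro rfl
    exact ⟨fun _ _ => rfl, fun k hk => hk, fun a b h => absurd h (lt_irrefl _)⟩

/-- Dykema's recurrence for the numbers of noncrossing linked partitions:
`f 1 = 1` and `f (n+1) = f n + ∑_{i=1}^{n} f i · f (n+1-i)` for `n ≥ 1`. -/
theorem ncl_recurrence :
    ncl 1 = 1 ∧ ∀ n : ℕ, 1 ≤ n →
      ncl (n + 1) = ncl n + ∑ i ∈ Finset.Icc 1 n, ncl i * ncl (n + 1 - i) := by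
  simp only [ncl_eq]
  refine ⟨?_, fun n _ => NCPar_rec n⟩
  rw [NCPar_rec 0, NCPar_zero]
  simp
end

section
/- For every natural number n, the number of noncrossing linked partitions of the set {1,2,...,n+1} equals the number of large Schröder paths of length 2n (the n-th large Schröder number S_n). -/
namespace NCLProof

/-! ### Numerical recursions -/

/-- Generating-tree recursion for noncrossing linked partitions. -/
def fT : ℕ → ℕ → ℕ
  | 0, _ => 1
  | n + 1, k => fT n (k + 1) + ∑ j ∈ Finset.range k, fT n (j + 2)

/-- First-step recursion for Schröder paths starting at height `h`. -/
def gT : ℕ → ℕ → ℕ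
  | 0, _ => 1
  | n + 1, 0 => gT n 1 + gT n 0
  | n + 1, h + 1 => gT n (h + 2) + gT n (h + 1) + gT (n + 1) h

open PowerSeries in
/-- The large Schröder series over the rationals. -/
noncomputable def SQ : PowerSeries ℚ := PowerSeries.map (Nat.castRingHom ℚ) largeSchroderSeries

open PowerSeries in
theorem SQ_eq : SQ = 1 + X * SQ + X * SQ ^ 2 := by
  have h := congrArg (PowerSeries.map (Nat.castRingHom ℚ))
    largeSchroderSeries_eq_one_add_X_mul_largeSchroderSeries_add_X_mul_largeSchroderSeries_sq
  simpa [SQ] using h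

open PowerSeries in
theorem SQ_const : constantCoeff SQ = 1 := by
  rw [SQ_eq]; simp

open PowerSeries in
/-- The little Schröder series over the rationals. -/
noncomputable def RQ : PowerSeries ℚ := C (1 / 2 : ℚ) * (SQ + 1)

open PowerSeries in
theorem two_RQ : 2 * RQ = SQ + 1 := by
  have : (2 : PowerSeries ℚ) = C (2 : ℚ) := (map_ofNat C 2).symm
  rw [RQ, this, ← mul_assoc, ← map_mul]
  norm_num

open PowerSeries in
theorem RQ_const : constantCoeff RQ = 1 := by
  simp [RQ, SQ_const]; norm_num

open PowerSeries in
theorem gT_eq (n h : ℕ) : (gT n h : ℚ) = coeff n (SQ ^ (h + 1)) := by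
  induction n generalizing h with
  | zero => simp [gT, SQ_const]
  | succ n ih =>
    induction h with
    | zero =>
      have e : SQ ^ (0 + 1) = 1 + X * (SQ ^ (1 + 1) + SQ ^ (0 + 1)) := by
        linear_combination SQ_eq
      rw [e, gT, map_add, coeff_succ_X_mul, map_add, ← ih, ← ih]
      simp [coeff_one]
    | succ h ih2 =>
      have e : SQ ^ (h + 1 + 1) = SQ ^ (h + 1) + X * (SQ ^ (h + 2 + 1) + SQ ^ (h + 1 + 1)) := by
        linear_combination SQ ^ (h + 1) * SQ_eq
      rw [e, gT, map_add, coeff_succ_X_mul, map_add, ← ih, ← ih, ← ih2]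
      push_cast; ring

open PowerSeries in
theorem fT_eq (n k : ℕ) : (fT n (k + 1) : ℚ) = coeff n (SQ * RQ ^ k) := by
  induction n generalizing k with
  | zero => simp [fT, SQ_const, RQ_const]
  | succ n ih =>
    induction k with
    | zero =>
      have e : SQ * RQ ^ 0 = 1 + X * (SQ * RQ ^ 1 + SQ * RQ ^ 1) := by
        linear_combination SQ_eq - X * SQ * two_RQ
      rw [e, fT, map_add, coeff_succ_X_mul, map_add, ← ih]
      simp [coeff_one]
    | succ k ih2 =>
      have e1 : 2 * (RQ - 1) = 2 * (X * (2 * RQ ^ 2 - RQ)) := by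
        linear_combination SQ_eq + two_RQ - X * (2 * RQ + SQ + 1) * two_RQ + X * two_RQ
      have e2 : RQ - 1 = X * (2 * RQ ^ 2 - RQ) := by
        have h2 : (2 : PowerSeries ℚ) = C (2 : ℚ) := (map_ofNat C 2).symm
        have h3 : C (1 / 2 : ℚ) * (2 : PowerSeries ℚ) = 1 := by
          rw [h2, ← map_mul]; norm_num
        have h4 := congrArg (C (1 / 2 : ℚ) * ·) e1
        simp only [← mul_assoc, h3, one_mul] at h4
        simpa only [mul_assoc] using h4
      have e : SQ * RQ ^ (k + 1) = SQ * RQ ^ k +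
          X * (SQ * RQ ^ (k + 2) + SQ * RQ ^ (k + 2) - SQ * RQ ^ (k + 1)) := by
        linear_combination SQ * RQ ^ k * e2
      rw [e, map_add, coeff_succ_X_mul, map_sub, map_add, ← ih, ← ih, ← ih2]
      rw [fT, fT, Finset.sum_range_succ]
      push_cast; ring

theorem fT_gT (n : ℕ) : fT n 1 = gT n 0 := by
  have h1 := fT_eq n 0
  have h2 := gT_eq n 0
  simp only [zero_add, pow_zero, mul_one, pow_one] at h1 h2
  exact_mod_cast h1.trans h2.symm

/-! ### Schröder paths -/

/-- Schröder paths from height `h` to `0` with `n` up or level steps. -/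
def P (n h : ℕ) : Set (List SStep) :=
  {p | sWidth p = 2 * n + h ∧ (∀ q : List SStep, q <+: p → 0 ≤ (h : ℤ) + sHeight q) ∧
    (h : ℤ) + sHeight p = 0}

theorem sW_nil : sWidth [] = 0 := rfl
theorem sH_nil : sHeight [] = 0 := rfl
theorem sW_cons (s : SStep) (p : List SStep) : sWidth (s :: p) = s.width + sWidth p := by
  simp [sWidth]
theorem sH_cons (s : SStep) (p : List SStep) : sHeight (s :: p) = s.height + sHeight p := by
  simp [sHeight]

theorem sH_le (p : List SStep) : -(sWidth p : ℤ) ≤ sHeight p := by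
  induction p with
  | nil => simp [sW_nil, sH_nil]
  | cons s p ih =>
    rw [sW_cons, sH_cons]
    cases s <;> simp [SStep.width, SStep.height] <;> omega

theorem pre_cons (h : ℤ) (s : SStep) (p : List SStep) :
    (∀ q : List SStep, q <+: s :: p → 0 ≤ h + sHeight q) ↔
      0 ≤ h ∧ ∀ q : List SStep, q <+: p → 0 ≤ h + s.height + sHeight q := by
  constructor
  · intro H
    refine ⟨by simpa [sH_nil] using H [] List.nil_prefix, fun q hq => ?_⟩
    have := H (s :: q) (by simpa using hq)
    rw [sH_cons] at this; linarith
  · rintro ⟨h0, H⟩ q hq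
    cases q with
    | nil => simpa [sH_nil] using h0
    | cons t q =>
      rw [List.cons_prefix_cons] at hq
      obtain ⟨rfl, hq⟩ := hq
      rw [sH_cons]; have := H q hq; linarith

theorem mem_P_nil (n h : ℕ) : [] ∈ P n h ↔ n = 0 ∧ h = 0 := by
  simp [P, sW_nil, sH_nil]; omega

theorem mem_P_U (n h : ℕ) (p : List SStep) :
    SStep.U :: p ∈ P n h ↔ ∃ m, n = m + 1 ∧ p ∈ P m (h + 1) := by
  simp only [P, Set.mem_ofPred_eq, pre_cons, sW_cons, sH_cons, SStep.width, SStep.height]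
  constructor
  · rintro ⟨hw, ⟨-, hq⟩, hh⟩
    have := sH_le p
    refine ⟨n - 1, by omega, by omega, ?_, by push_cast; linarith⟩
    intro q h1; have := hq q h1; push_cast; linarith
  · rintro ⟨m, rfl, hw, hq, hh⟩
    refine ⟨by omega, ⟨by omega, ?_⟩, by push_cast at hh; linarith⟩
    intro q h1; have := hq q h1; push_cast at this; linarith

theorem mem_P_L (n h : ℕ) (p : List SStep) :
    SStep.L :: p ∈ P n h ↔ ∃ m, n = m + 1 ∧ p ∈ P m h := by
  simp only [P, Set.mem_ofPred_eq, pre_cons, sW_cons, sH_cons, SStep.width, SStep.height]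
  constructor
  · rintro ⟨hw, ⟨-, hq⟩, hh⟩
    have := sH_le p
    refine ⟨n - 1, by omega, by omega, ?_, by linarith⟩
    intro q h1; have := hq q h1; linarith
  · rintro ⟨m, rfl, hw, hq, hh⟩
    refine ⟨by omega, ⟨by omega, ?_⟩, by linarith⟩
    intro q h1; have := hq q h1; linarith

theorem mem_P_D (n h : ℕ) (p : List SStep) :
    SStep.D :: p ∈ P n h ↔ ∃ m, h = m + 1 ∧ p ∈ P n m := by
  simp only [P, Set.mem_ofPred_eq, pre_cons, sW_cons, sH_cons, SStep.width, SStep.height]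
  constructor
  · rintro ⟨hw, ⟨-, hq⟩, hh⟩
    have h0 := hq [] List.nil_prefix
    rw [sH_nil] at h0
    obtain ⟨m, rfl⟩ : ∃ m, h = m + 1 := ⟨h - 1, by omega⟩
    refine ⟨m, rfl, by omega, ?_, by push_cast at hh; linarith⟩
    intro q h1; have := hq q h1; push_cast at this; linarith
  · rintro ⟨m, rfl, hw, hq, hh⟩
    refine ⟨by omega, ⟨by omega, ?_⟩, by push_cast; linarith⟩
    intro q h1; have := hq q h1; push_cast; linarith

theorem enc_cons (s : SStep) (A : Set (List SStep)) :
    (List.cons s '' A).encard = A.encard :=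
  (List.cons_injective (a := s)).encard_image A

theorem disj_cons {s t : SStep} (h : s ≠ t) (A B : Set (List SStep)) :
    Disjoint (List.cons s '' A) (List.cons t '' B) := by
  rw [Set.disjoint_left]
  rintro _ ⟨a, -, rfl⟩ ⟨b, -, hb⟩
  simp only [List.cons.injEq] at hb
  exact h hb.1.symm

theorem P_zero_succ (h : ℕ) : P 0 (h + 1) = List.cons SStep.D '' P 0 h := by
  ext p
  rcases p with _ | ⟨_ | _ | _, p⟩ <;> simp [mem_P_nil, mem_P_U, mem_P_L, mem_P_D]

theorem P_succ_zero (n : ℕ) :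
    P (n + 1) 0 = List.cons SStep.U '' P n 1 ∪ List.cons SStep.L '' P n 0 := by
  ext p
  rcases p with _ | ⟨_ | _ | _, p⟩ <;> simp [mem_P_nil, mem_P_U, mem_P_L, mem_P_D]

theorem P_succ_succ (n h : ℕ) :
    P (n + 1) (h + 1) = (List.cons SStep.U '' P n (h + 2) ∪ List.cons SStep.L '' P n (h + 1)) ∪
      List.cons SStep.D '' P (n + 1) h := by
  ext p
  rcases p with _ | ⟨_ | _ | _, p⟩ <;> simp [mem_P_nil, mem_P_U, mem_P_L, mem_P_D]

theorem P_encard (n h : ℕ) : (P n h).encard = (gT n h : ℕ∞) := by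
  induction n generalizing h with
  | zero =>
    induction h with
    | zero =>
      have : P 0 0 = {[]} := by
        ext p
        rcases p with _ | ⟨_ | _ | _, p⟩ <;> simp [mem_P_nil, mem_P_U, mem_P_L, mem_P_D]
      rw [this]; simp [gT]
    | succ h ih => rw [P_zero_succ, enc_cons, ih]; simp [gT]
  | succ n ih =>
    induction h with
    | zero =>
      rw [P_succ_zero, Set.encard_union_eq (disj_cons (by decide) _ _), enc_cons, enc_cons,
        ih, ih, gT]
      push_cast; rfl
    | succ h ih2 =>
      rw [P_succ_succ, Set.encard_union_eq, Set.encard_union_eq (disj_cons (by decide) _ _),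
        enc_cons, enc_cons, enc_cons, ih, ih, ih2, gT]
      · push_cast; rfl
      · rw [Set.disjoint_union_left]
        exact ⟨disj_cons (by decide) _ _, disj_cons (by decide) _ _⟩

theorem schroeder_eq (n : ℕ) : SchroederLarge n = gT n 0 := by
  have : {p : List SStep | IsLargeSchroeder n p} = P n 0 := by
    ext p; simp [P, IsLargeSchroeder]
  rw [SchroederLarge, this, Set.ncard, P_encard]; rfl

/-! ### Parent functions -/

/-- Noncrossing parent functions on `{1,…,n}` (value `0` meaning no parent). -/
def W (n : ℕ) (p : ℕ → ℕ) : Prop :=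
  (∀ i, p i ≠ 0 → i ≤ n) ∧ (∀ i, p i ≠ 0 → p i < i) ∧
  (∀ c d, p c ≠ 0 → p c < p d → p d < c → c < d → False)

open Classical in
/-- Vertices that may still receive a child. -/
noncomputable def avail (n : ℕ) (p : ℕ → ℕ) : Finset ℕ :=
  (Finset.Icc 1 n).filter fun b => ∀ c ∈ Finset.Icc 1 n, ¬ (p c ≠ 0 ∧ p c < b ∧ b < c)

theorem mem_avail (n : ℕ) (p : ℕ → ℕ) (b : ℕ) : b ∈ avail n p ↔
    (1 ≤ b ∧ b ≤ n) ∧ ∀ c, 1 ≤ c → c ≤ n → p c ≠ 0 → p c < b → c ≤ b := by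
  simp only [avail, Finset.mem_filter, Finset.mem_Icc, not_and, not_lt, and_imp]

theorem W_update {n : ℕ} {p : ℕ → ℕ} (hp : W n p) {v : ℕ} (hv : v ∈ insert 0 (avail n p)) :
    W (n + 1) (Function.update p (n + 1) v) := by
  obtain ⟨h1, h2, h3⟩ := hp
  simp only [Finset.mem_insert, mem_avail] at hv
  refine ⟨?_, ?_, ?_⟩
  · intro i hi
    by_cases hh : i = n + 1
    · omega
    · rw [Function.update_of_ne hh] at hi
      have := h1 i hi; omega
  · intro i hi
    by_cases hh : i = n + 1
    · subst hh; rw [Function.update_self] at hi ⊢; omega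
    · rw [Function.update_of_ne hh] at hi ⊢
      exact h2 i hi
  · intro c d hc hcd hdc hlt
    have hd : d ≤ n + 1 := by
      by_contra hd
      rw [Function.update_of_ne (by omega : d ≠ n + 1)] at hcd
      have := h1 d (by omega); omega
    rw [Function.update_of_ne (by omega : c ≠ n + 1)] at hc hcd
    by_cases hh : d = n + 1
    · subst hh
      rw [Function.update_self] at hcd hdc
      rcases hv with rfl | hv
      · omega
      · have := hv.2 c (by omega) (by omega) hc hcd; omega
    · rw [Function.update_of_ne hh] at hcd hdc
      exact h3 c d hc hcd hdc hlt

theorem avail_update_zero {n : ℕ} {p : ℕ → ℕ} :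
    avail (n + 1) (Function.update p (n + 1) 0) = insert (n + 1) (avail n p) := by
  ext b
  simp only [Finset.mem_insert, mem_avail, Function.update_apply]
  grind

theorem avail_update {n : ℕ} {p : ℕ → ℕ} {v : ℕ} (hv : v ∈ avail n p) :
    avail (n + 1) (Function.update p (n + 1) v) =
      insert (n + 1) ((avail n p).filter (· ≤ v)) := by
  rw [mem_avail] at hv
  ext b
  simp only [Finset.mem_insert, Finset.mem_filter, mem_avail, Function.update_apply]
  grind

theorem card_avail_zero {n : ℕ} {p : ℕ → ℕ} :
    (avail (n + 1) (Function.update p (n + 1) 0)).card = (avail n p).card + 1 := by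
  rw [avail_update_zero, Finset.card_insert_of_notMem]
  rw [mem_avail]; omega

theorem card_avail {n : ℕ} {p : ℕ → ℕ} {v : ℕ} (hv : v ∈ avail n p) :
    (avail (n + 1) (Function.update p (n + 1) v)).card =
      ((avail n p).filter (· ≤ v)).card + 1 := by
  rw [avail_update hv, Finset.card_insert_of_notMem]
  rw [Finset.mem_filter, mem_avail]; omega

theorem sum_rank (s : Finset ℕ) (F : ℕ → ℕ) :
    ∑ b ∈ s, F (s.filter (· ≤ b)).card = ∑ j ∈ Finset.range s.card, F (j + 1) := by
  induction s using Finset.induction_on_max with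
  | empty => simp
  | insert a s ha ih =>
    have hn : a ∉ s := fun h => lt_irrefl _ (ha a h)
    rw [Finset.sum_insert hn, Finset.card_insert_of_notMem hn, Finset.sum_range_succ, ← ih,
      add_comm]
    congr 1
    · apply Finset.sum_congr rfl
      intro b hb
      rw [Finset.filter_insert, if_neg (by have := ha b hb; omega)]
    · rw [Finset.filter_true_of_mem, Finset.card_insert_of_notMem hn]
      intro x hx
      rcases Finset.mem_insert.1 hx with rfl | hx
      · rfl
      · exact (ha x hx).le

open Classical in
/-- All extensions of a parent function by `m` further vertices. -/
noncomputable def ext : ℕ → ℕ → (ℕ → ℕ) → Finset (ℕ → ℕ)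
  | 0, _, p => {p}
  | m + 1, n, p => (insert 0 (avail n p)).biUnion fun v =>
      ext m (n + 1) (Function.update p (n + 1) v)

theorem mem_ext (m n : ℕ) (p : ℕ → ℕ) (hp : W n p) (q : ℕ → ℕ) :
    q ∈ ext m n p ↔ W (n + m) q ∧ ∀ i ≤ n, q i = p i := by
  induction m generalizing n p with
  | zero =>
    simp only [ext, Finset.mem_singleton, add_zero]
    constructor
    · rintro rfl; exact ⟨hp, fun _ _ => rfl⟩
    · rintro ⟨hq, h⟩
      funext i
      by_cases hi : i ≤ n
      · exact h i hi
      · have h1 := hq.1 i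
        have h2 := hp.1 i
        by_cases e1 : q i = 0 <;> by_cases e2 : p i = 0 <;> grind
  | succ m ih =>
    simp only [ext, Finset.mem_biUnion]
    constructor
    · rintro ⟨v, hv, hq⟩
      rw [ih _ _ (W_update hp hv)] at hq
      refine ⟨by rw [show n + (m + 1) = n + 1 + m by omega]; exact hq.1, fun i hi => ?_⟩
      rw [hq.2 i (by omega), Function.update_of_ne (by omega)]
    · rintro ⟨hq, h⟩
      have hv : q (n + 1) ∈ insert 0 (avail n p) := by
        rw [Finset.mem_insert, mem_avail]
        by_cases h0 : q (n + 1) = 0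
        · exact Or.inl h0
        · right
          refine ⟨⟨by omega, by have := hq.2.1 _ h0; omega⟩, ?_⟩
          intro c hc1 hc2 hc3 hc4
          by_contra hlt
          have := h c hc2
          exact hq.2.2 c (n + 1) (by omega) (by omega) (by omega) (by omega)
      refine ⟨_, hv, ?_⟩
      rw [ih _ _ (W_update hp hv)]
      refine ⟨by rw [show n + 1 + m = n + (m + 1) by omega]; exact hq, fun i hi => ?_⟩
      by_cases hh : i = n + 1
      · subst hh; rw [Function.update_self]
      · rw [Function.update_of_ne hh]; exact h i (by omega)

theorem card_ext (m n : ℕ) (p : ℕ → ℕ) (hp : W n p) :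
    (ext m n p).card = fT m (avail n p).card := by
  classical
  induction m generalizing n p with
  | zero => simp [ext, fT]
  | succ m ih =>
    rw [ext, Finset.card_biUnion]
    · rw [Finset.sum_insert (by rw [mem_avail]; omega)]
      rw [ih _ _ (W_update hp (by simp)), card_avail_zero, fT]
      congr 1
      rw [← sum_rank (avail n p) (fun j => fT m (j + 1))]
      apply Finset.sum_congr rfl
      intro v hv
      rw [ih _ _ (W_update hp (Finset.mem_insert_of_mem hv)), card_avail hv]
    · intro v hv w hw hne
      change Disjoint (ext _ _ _) (ext _ _ _)
      rw [Finset.disjoint_left]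
      intro q h1 h2
      rw [mem_ext _ _ _ (W_update hp (Finset.mem_coe.1 hv))] at h1
      rw [mem_ext _ _ _ (W_update hp (Finset.mem_coe.1 hw))] at h2
      have e1 := h1.2 (n + 1) le_rfl
      have e2 := h2.2 (n + 1) le_rfl
      rw [Function.update_self] at e1 e2
      exact hne (e1.symm.trans e2)

theorem W_zero : W 0 (fun _ => 0) := by
  refine ⟨?_, ?_, ?_⟩ <;> simp

theorem W_ncard (n : ℕ) : {p | W n p}.ncard = fT n 0 := by
  have : {p | W n p} = (ext n 0 (fun _ => 0) : Set (ℕ → ℕ)) := by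
    ext p
    rw [Finset.mem_coe, mem_ext _ _ _ W_zero]
    simp only [zero_add, Set.mem_ofPred_eq]
    constructor
    · intro h
      refine ⟨h, fun i hi => ?_⟩
      by_contra h0
      have := h.2.1 i h0; omega
    · exact fun h => h.1
  rw [this, Set.ncard_coe_finset, card_ext _ _ _ W_zero]
  simp [avail]

/-! ### From parent functions to linked partitions -/

/-- The block with minimum `m`. -/
def blk (n : ℕ) (p : ℕ → ℕ) (m : ℕ) : Finset ℕ :=
  insert m ((Finset.Icc 1 n).filter fun i => p i = m)

open Classical in
/-- The linked partition of a parent function. -/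
noncomputable def Phi (n : ℕ) (p : ℕ → ℕ) : Finset (Finset ℕ) :=
  ((Finset.Icc 1 n).filter fun m => p m = 0 ∨ ∃ i ∈ Finset.Icc 1 n, p i = m).image (blk n p)

theorem mem_blk (n : ℕ) (p : ℕ → ℕ) (m i : ℕ) :
    i ∈ blk n p m ↔ i = m ∨ ((1 ≤ i ∧ i ≤ n) ∧ p i = m) := by
  simp [blk]

theorem mem_Phi (n : ℕ) (p : ℕ → ℕ) (B : Finset ℕ) :
    B ∈ Phi n p ↔ ∃ m, ((1 ≤ m ∧ m ≤ n) ∧ (p m = 0 ∨ ∃ i, (1 ≤ i ∧ i ≤ n) ∧ p i = m)) ∧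
      blk n p m = B := by
  simp [Phi]

theorem blk_min {n : ℕ} {p : ℕ → ℕ} (hp : W n p) {m : ℕ} (hm : 1 ≤ m) :
    ∀ j ∈ blk n p m, m ≤ j := by
  intro j hj
  rw [mem_blk] at hj
  have := hp.2.1 j
  omega

/-- `m` is the minimum of a block in which `i` is a different element. -/
def Par (π : Finset (Finset ℕ)) (i m : ℕ) : Prop :=
  ∃ B ∈ π, i ∈ B ∧ m ∈ B ∧ (∀ j ∈ B, m ≤ j) ∧ m < i

theorem Par_Phi {n : ℕ} {p : ℕ → ℕ} (hp : W n p) {i m : ℕ} :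
    Par (Phi n p) i m ↔ p i = m ∧ m ≠ 0 := by
  constructor
  · rintro ⟨B, hB, hi, hm, hmin, hlt⟩
    rw [mem_Phi] at hB
    obtain ⟨k, ⟨hk, -⟩, rfl⟩ := hB
    have h1 := blk_min hp hk.1 m hm
    have h2 := hmin k (by rw [mem_blk]; exact Or.inl rfl)
    rw [mem_blk] at hi
    omega
  · rintro ⟨h, h0⟩
    have h1 := hp.1 i (by omega)
    have h2 := hp.2.1 i (by omega)
    refine ⟨blk n p m, ?_, ?_, ?_, blk_min hp (by omega), by omega⟩
    · rw [mem_Phi]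
      exact ⟨m, ⟨by omega, Or.inr ⟨i, by omega, h⟩⟩, rfl⟩
    · rw [mem_blk]; right; exact ⟨by omega, h⟩
    · rw [mem_blk]; exact Or.inl rfl

theorem Phi_inj (n : ℕ) : Set.InjOn (Phi n) {p | W n p} := by
  intro p hp q hq h
  funext i
  have h1 := fun m => @Par_Phi n p hp i m
  have h2 := fun m => @Par_Phi n q hq i m
  rw [h] at h1
  by_cases e1 : p i = 0
  · by_cases e2 : q i = 0
    · rw [e1, e2]
    · exact ((h1 _).1 ((h2 _).2 ⟨rfl, e2⟩)).1
  · exact ((h2 _).1 ((h1 _).2 ⟨rfl, e1⟩)).1.symm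

theorem Phi_linked {n : ℕ} {p : ℕ → ℕ} (hp : W n p) : IsLinkedPartition n (Phi n p) := by
  refine ⟨?_, ?_, ?_⟩
  · intro B hB
    rw [mem_Phi] at hB
    obtain ⟨m, ⟨hm, -⟩, rfl⟩ := hB
    refine ⟨⟨m, by rw [mem_blk]; exact Or.inl rfl⟩, fun i hi => ?_⟩
    rw [mem_blk] at hi
    rw [Finset.mem_Icc]; omega
  · intro i hi
    rw [Finset.mem_Icc] at hi
    by_cases h0 : p i = 0
    · exact ⟨blk n p i, (mem_Phi _ _ _).2 ⟨i, ⟨hi, Or.inl h0⟩, rfl⟩, by simp [mem_blk]⟩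
    · obtain ⟨B, hB, hi, -⟩ := (Par_Phi hp).2 ⟨rfl, h0⟩
      exact ⟨B, hB, hi⟩
  · have key : ∀ m m', 1 ≤ m → 1 ≤ m' → (p m = 0 ∨ ∃ i, (1 ≤ i ∧ i ≤ n) ∧ p i = m) →
        m ≤ n → p m = m' →
        ((∀ j ∈ blk n p m, m ≤ j) ∧ 1 < (blk n p m).card ∧ ¬ (∀ j ∈ blk n p m', m ≤ j)) := by
      intro m m' hm hm' hor hn h
      refine ⟨blk_min hp hm, ?_, ?_⟩
      · obtain ⟨i, hi, hpi⟩ := hor.resolve_left (by omega)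
        have := hp.2.1 i (by omega)
        rw [Finset.one_lt_card]
        exact ⟨m, by simp [mem_blk], i, by rw [mem_blk]; right; exact ⟨hi, hpi⟩, by omega⟩
      · intro hall
        have h1 := hall m' (by simp [mem_blk])
        have := hp.2.1 m (by omega)
        omega
    intro B hB B' hB' hne k hk hk'
    rw [mem_Phi] at hB hB'
    obtain ⟨m, ⟨hm, hor⟩, rfl⟩ := hB
    obtain ⟨m', ⟨hm', hor'⟩, rfl⟩ := hB'
    have hmm : m ≠ m' := fun h => hne (by rw [h])
    rw [mem_blk] at hk hk'
    rcases hk with rfl | hk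
    · left
      exact key k m' hm.1 hm'.1 hor hm.2 (hk'.resolve_left hmm).2
    · rcases hk' with rfl | hk'
      · right
        exact key k m hm'.1 hm.1 hor' hm'.2 hk.2
      · omega

theorem Phi_nc {n : ℕ} {p : ℕ → ℕ} (hp : W n p) : IsNoncrossing (Phi n p) := by
  rintro ⟨B, hB, B', hB', hne, i, hi, j, hj, i', hi', j', hj', h1, h2, h3⟩
  rw [mem_Phi] at hB hB'
  obtain ⟨m, ⟨hm, -⟩, rfl⟩ := hB
  obtain ⟨m', ⟨hm', -⟩, rfl⟩ := hB'
  have hmm : m ≠ m' := fun h => hne (by rw [h])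
  have a1 := blk_min hp hm.1 i hi
  have a2 := blk_min hp hm'.1 i' hi'
  rw [mem_blk] at hi hi' hj hj'
  have b1 : p j = m := by omega
  have b2 : p j' = m' := by omega
  by_cases hlt : m < m'
  · exact hp.2.2 j j' (by omega) (by omega) (by omega) (by omega)
  · have b3 : p i' = m' := by omega
    exact hp.2.2 i' j (by omega) (by omega) (by omega) (by omega)

theorem Phi_surj {n : ℕ} {π : Finset (Finset ℕ)} (h : IsLinkedPartition n π)
    (hnc : IsNoncrossing π) : ∃ p, W n p ∧ Phi n p = π := by
  classical
  obtain ⟨hA, hB, hC⟩ := h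
  have uniq : ∀ B ∈ π, ∀ B' ∈ π, ∀ i, i ∈ B → i ∈ B' → (∃ j ∈ B, j < i) → (∃ j ∈ B', j < i) →
      B = B' := by
    intro B hB1 B' hB1' i hi hi' ⟨j, hj, hji⟩ ⟨j', hj', hji'⟩
    by_contra hne
    rcases hC B hB1 B' hB1' hne i hi hi' with ⟨h, -⟩ | ⟨h, -⟩
    · have := h j hj; omega
    · have := h j' hj'; omega
  have uniqmin : ∀ B ∈ π, ∀ B' ∈ π, ∀ i, i ∈ B → i ∈ B' → (∀ j ∈ B, i ≤ j) →
      (∀ j ∈ B', i ≤ j) → B = B' := by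
    intro B hB1 B' hB1' i hi hi' h1 h2
    by_contra hne
    rcases hC B hB1 B' hB1' hne i hi hi' with ⟨-, -, h⟩ | ⟨-, -, h⟩
    · exact h h2
    · exact h h1
  have hmin : ∀ B ∈ π, ∃ m ∈ B, ∀ j ∈ B, m ≤ j := fun B hB1 =>
    ⟨B.min' (hA B hB1).1, Finset.min'_mem _ _, fun j hj => Finset.min'_le _ _ hj⟩
  have parU : ∀ i m m', Par π i m → Par π i m' → m = m' := by
    rintro i m m' ⟨B, h1, h2, h3, h4, h5⟩ ⟨B', h1', h2', h3', h4', h5'⟩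
    obtain rfl := uniq B h1 B' h1' i h2 h2' ⟨m, h3, h5⟩ ⟨m', h3', h5'⟩
    exact le_antisymm (h4 _ h3') (h4' _ h3)
  have bd : ∀ B ∈ π, ∀ i ∈ B, 1 ≤ i ∧ i ≤ n := fun B hB1 i hi =>
    Finset.mem_Icc.1 ((hA B hB1).2 hi)
  obtain ⟨p, hp⟩ : ∃ p : ℕ → ℕ, ∀ i m, (p i = m ∧ m ≠ 0) ↔ Par π i m := by
    refine ⟨fun i => if h : ∃ m, Par π i m then h.choose else 0, fun i m => ?_⟩
    have pos : ∀ m, Par π i m → m ≠ 0 := by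
      rintro m ⟨B, h1, h2, h3, -⟩
      have := bd B h1 m h3; omega
    by_cases h : ∃ m, Par π i m
    · simp only [dif_pos h]
      constructor
      · rintro ⟨h1, -⟩; rw [← h1]; exact h.choose_spec
      · intro h1; exact ⟨parU _ _ _ h.choose_spec h1, pos _ h1⟩
    · simp only [dif_neg h]
      constructor
      · rintro ⟨h1, h2⟩; exact absurd h1.symm h2
      · intro h1; exact absurd ⟨m, h1⟩ h
  have hp' : ∀ i, p i ≠ 0 → Par π i (p i) := fun i hi => (hp i _).1 ⟨rfl, hi⟩
  have hW : W n p := by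
    refine ⟨?_, ?_, ?_⟩
    · intro i hi
      obtain ⟨B, h1, h2, -⟩ := hp' i hi
      exact (bd B h1 i h2).2
    · intro i hi
      obtain ⟨B, h1, h2, h3, h4, h5⟩ := hp' i hi
      exact h5
    · intro c d hc h1 h2 h3
      obtain ⟨B, b1, b2, b3, b4, b5⟩ := hp' c hc
      obtain ⟨B', c1, c2, c3, c4, c5⟩ := hp' d (by omega)
      refine hnc ⟨B, b1, B', c1, ?_, p c, b3, c, b2, p d, c3, d, c2, h1, h2, h3⟩
      rintro rfl
      have := c4 _ b3; omega
  have hblk : ∀ B ∈ π, ∀ m ∈ B, (∀ j ∈ B, m ≤ j) → blk n p m = B := by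
    intro B hB1 m hm hmin
    ext i
    rw [mem_blk]
    constructor
    · rintro (rfl | ⟨hi, hpi⟩)
      · exact hm
      · have := bd B hB1 m hm
        obtain ⟨B', c1, c2, c3, c4, c5⟩ := hp' i (by omega)
        rw [hpi] at c3 c4
        rw [uniqmin B hB1 B' c1 m hm c3 hmin c4]
        exact c2
    · intro hi
      by_cases him : i = m
      · exact Or.inl him
      · right
        have := hmin i hi
        exact ⟨bd B hB1 i hi, ((hp i m).2 ⟨B, hB1, hi, hm, hmin, by omega⟩).1⟩
  refine ⟨p, hW, ?_⟩
  ext B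
  rw [mem_Phi]
  constructor
  · rintro ⟨m, ⟨hm, hor⟩, rfl⟩
    have : ∃ B ∈ π, m ∈ B ∧ ∀ j ∈ B, m ≤ j := by
      rcases hor with h0 | ⟨i, hi, hpi⟩
      · obtain ⟨B, hB1, hmB⟩ := hB m (Finset.mem_Icc.2 hm)
        refine ⟨B, hB1, hmB, ?_⟩
        obtain ⟨k, hk, hkmin⟩ := hmin B hB1
        by_cases hkm : k < m
        · have := (hp m k).2 ⟨B, hB1, hmB, hk, hkmin, hkm⟩
          omega
        · intro j hj; have := hkmin j hj; omega
      · obtain ⟨B', c1, c2, c3, c4, c5⟩ := hp' i (by omega)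
        rw [hpi] at c3 c4
        exact ⟨B', c1, c3, c4⟩
    obtain ⟨B, hB1, hm1, hm2⟩ := this
    rw [hblk B hB1 m hm1 hm2]; exact hB1
  · intro hB1
    obtain ⟨m, hm, hmm⟩ := hmin B hB1
    refine ⟨m, ⟨bd B hB1 m hm, ?_⟩, hblk B hB1 m hm hmm⟩
    by_cases hch : ∃ i ∈ B, i ≠ m
    · obtain ⟨i, hi, him⟩ := hch
      right
      have := hmm i hi
      exact ⟨i, bd B hB1 i hi, ((hp i m).2 ⟨B, hB1, hi, hm, hmm, by omega⟩).1⟩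
    · left
      by_contra h0
      obtain ⟨B', c1, c2, c3, c4, c5⟩ := hp' m h0
      have hne : B ≠ B' := by
        rintro rfl
        have := hmm _ c3; omega
      rcases hC B hB1 B' c1 hne m hm c2 with ⟨-, h, -⟩ | ⟨h, -⟩
      · obtain ⟨x, hx, y, hy, hxy⟩ := Finset.one_lt_card.1 h
        apply hch
        by_cases hxm : x = m
        · exact ⟨y, hy, by omega⟩
        · exact ⟨x, hx, hxm⟩
      · have := h _ c3; omega

theorem ncl_eq (n : ℕ) : ncl n = fT n 0 := by
  rw [ncl, ← W_ncard n, ← Set.InjOn.ncard_image (Phi_inj n)]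
  congr 1
  ext π
  simp only [Set.mem_ofPred_eq, Set.mem_image]
  constructor
  · rintro ⟨h1, h2⟩; exact Phi_surj h1 h2
  · rintro ⟨p, hp, rfl⟩; exact ⟨Phi_linked hp, Phi_nc hp⟩

end NCLProof

/-- The number of noncrossing linked partitions of `{1,…,n+1}` equals the
`n`-th large Schröder number. -/
theorem ncl_eq_schroeder_large (n : ℕ) : ncl (n + 1) = SchroederLarge n := by
  rw [NCLProof.ncl_eq, NCLProof.schroeder_eq, ← NCLProof.fT_gT, NCLProof.fT]
  simp
end

section
/- For every integer n ≥ 1, the number of (3,2)-Motzkin paths of length n − 1 equals the number of little Schröder paths of length 2n; that is, m_{n−1} = s_n. -/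
/-- Generalised Motzkin suffix condition starting at height `h`. -/
def MP (n : ℕ) (h : ℤ) (p : List MStep) : Prop :=
  p.length = n ∧ (∀ q : List MStep, q <+: p → 0 ≤ h + mHeight q) ∧ h + mHeight p = 0

/-- Generalised little Schröder suffix condition starting at height `h`. -/
def SP (w : ℕ) (h : ℤ) (p : List SStep) : Prop :=
  sWidth p = w ∧ (∀ q : List SStep, q <+: p → 0 ≤ h + sHeight q) ∧ h + sHeight p = 0 ∧
    ∀ a b : List SStep, p = a ++ SStep.L :: b → 0 < h + sHeight a

theorem sHeight_cons (s : SStep) (p : List SStep) : sHeight (s :: p) = s.height + sHeight p := by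
  simp [sHeight]

theorem sWidth_cons (s : SStep) (p : List SStep) : sWidth (s :: p) = s.width + sWidth p := by
  simp [sWidth]

theorem sHeight_nil : sHeight [] = 0 := rfl
theorem sWidth_nil : sWidth [] = 0 := rfl

theorem MP_nonneg {n : ℕ} {h : ℤ} {p : List MStep} (H : MP n h p) : 0 ≤ h := by
  have := H.2.1 [] List.nil_prefix
  simpa [mHeight_nil] using this

theorem SP_nonneg {n : ℕ} {h : ℤ} {p : List SStep} (H : SP n h p) : 0 ≤ h := by
  have := H.2.1 [] List.nil_prefix
  simpa [sHeight_nil] using this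

theorem neg_sHeight_le (p : List SStep) : -sHeight p ≤ sWidth p := by
  induction p with
  | nil => simp [sHeight_nil, sWidth_nil]
  | cons s p ih =>
    rw [sHeight_cons, sWidth_cons]
    cases s <;> simp [SStep.height, SStep.width] <;> omega

theorem SP_le {n : ℕ} {h : ℤ} {p : List SStep} (H : SP n h p) : h ≤ n := by
  have h1 := neg_sHeight_le p
  have h2 := H.1
  have h3 := H.2.2.1
  omega

theorem MP_nil (n : ℕ) (h : ℤ) : MP n h [] ↔ n = 0 ∧ h = 0 := by
  constructor
  · rintro ⟨h1, -, h3⟩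
    simp [mHeight_nil] at h1 h3
    omega
  · rintro ⟨rfl, rfl⟩
    refine ⟨rfl, ?_, by simp [mHeight_nil]⟩
    intro q hq
    rw [List.prefix_nil.mp hq]; simp [mHeight_nil]

theorem SP_nil (n : ℕ) (h : ℤ) : SP n h [] ↔ n = 0 ∧ h = 0 := by
  constructor
  · rintro ⟨h1, -, h3, -⟩
    simp [sHeight_nil, sWidth_nil] at h1 h3
    omega
  · rintro ⟨rfl, rfl⟩
    refine ⟨rfl, ?_, by simp [sHeight_nil], by simp⟩
    intro q hq
    rw [List.prefix_nil.mp hq]; simp [sHeight_nil]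

theorem MP_cons (n : ℕ) (h : ℤ) (s : MStep) (p : List MStep) :
    MP n h (s :: p) ↔ 0 ≤ h ∧ ∃ m, n = m + 1 ∧ MP m (h + s.height) p := by
  constructor
  · intro H
    refine ⟨MP_nonneg H, p.length, H.1.symm, rfl, ?_, ?_⟩
    · intro q hq
      have := H.2.1 (s :: q) (by simpa using hq)
      rw [mHeight_cons] at this; omega
    · have := H.2.2
      rw [mHeight_cons] at this; omega
  · rintro ⟨h0, m, rfl, h1, h2, h3⟩
    refine ⟨by simp [h1], ?_, by rw [mHeight_cons]; omega⟩
    intro q hq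
    rcases List.prefix_cons_iff.mp hq with rfl | ⟨t, rfl, ht⟩
    · simpa [mHeight_nil] using h0
    · have := h2 t ht
      rw [mHeight_cons]; omega

theorem SP_cons (n : ℕ) (h : ℤ) (s : SStep) (p : List SStep) :
    SP n h (s :: p) ↔ 0 ≤ h ∧ (s = SStep.L → 0 < h) ∧
      ∃ m, n = m + s.width ∧ SP m (h + s.height) p := by
  constructor
  · intro H
    refine ⟨SP_nonneg H, ?_, sWidth p, ?_, rfl, ?_, ?_, ?_⟩
    · rintro rfl
      have := H.2.2.2 [] p rfl
      simpa [sHeight_nil] using this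
    · have := H.1
      rw [sWidth_cons] at this; omega
    · intro q hq
      have := H.2.1 (s :: q) (by simpa using hq)
      rw [sHeight_cons] at this; omega
    · have := H.2.2.1
      rw [sHeight_cons] at this; omega
    · intro a b hab
      have := H.2.2.2 (s :: a) b (by simp [hab])
      rw [sHeight_cons] at this; omega
  · rintro ⟨h0, hL, m, rfl, h1, h2, h3, h4⟩
    refine ⟨by rw [sWidth_cons]; omega, ?_, by rw [sHeight_cons]; omega, ?_⟩
    · intro q hq
      rcases List.prefix_cons_iff.mp hq with rfl | ⟨t, rfl, ht⟩
      · simpa [sHeight_nil] using h0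
      · have := h2 t ht
        rw [sHeight_cons]; omega
    · intro a b hab
      cases a with
      | nil =>
        simp at hab
        simpa [sHeight_nil] using hL hab.1
      | cons x a =>
        simp at hab
        obtain ⟨rfl, hab⟩ := hab
        have := h4 a b hab
        rw [sHeight_cons]; omega

/-- Prepend a step to every list of a finset. -/
def pre {α : Type} (s : α) (F : Finset (List α)) : Finset (List α) :=
  F.map ⟨List.cons s, List.cons_injective⟩

theorem mem_pre_nil {α : Type} (s : α) (F : Finset (List α)) : [] ∉ pre s F := by
  simp [pre]

theorem mem_pre_cons {α : Type} (s t : α) (F : Finset (List α)) (p : List α) :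
    t :: p ∈ pre s F ↔ t = s ∧ p ∈ F := by
  simp only [pre, Finset.mem_map, Function.Embedding.coeFn_mk, List.cons.injEq]
  constructor
  · rintro ⟨a, ha, rfl, rfl⟩; exact ⟨rfl, ha⟩
  · rintro ⟨rfl, h⟩; exact ⟨p, h, rfl, rfl⟩

theorem card_pre {α : Type} (s : α) (F : Finset (List α)) : (pre s F).card = F.card := by
  simp [pre]

theorem disj_pre {α : Type} {s t : α} (h : s ≠ t) (F G : Finset (List α)) :
    Disjoint (pre s F) (pre t G) := by
  rw [Finset.disjoint_left]
  intro p hp hq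
  cases p with
  | nil => exact mem_pre_nil _ _ hp
  | cons x p =>
    rw [mem_pre_cons] at hp hq
    exact h (hp.1.symm.trans hq.1)

/-- Motzkin suffixes of length `n` from height `h`. -/
def mF : ℕ → ℕ → Finset (List MStep)
  | 0, 0 => {[]}
  | 0, _ + 1 => ∅
  | n + 1, 0 => pre .U (mF n 1) ∪ (pre .L1 (mF n 0) ∪ (pre .L2 (mF n 0) ∪ pre .L3 (mF n 0)))
  | n + 1, h + 1 => pre .U (mF n (h + 2)) ∪ (pre .L1 (mF n (h + 1)) ∪ (pre .L2 (mF n (h + 1)) ∪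
      (pre .L3 (mF n (h + 1)) ∪ (pre .D1 (mF n h) ∪ pre .D2 (mF n h)))))

/-- Schröder suffixes of width `2n+j` from height `j`. -/
def cF : ℕ → ℕ → Finset (List SStep)
  | 0, 0 => {[]}
  | 0, j + 1 => pre .D (cF 0 j)
  | n + 1, 0 => pre .U (cF n 1)
  | n + 1, j + 1 => pre .U (cF n (j + 2)) ∪ (pre .L (cF n (j + 1)) ∪ pre .D (cF (n + 1) j))

theorem mem_mF (p : List MStep) : ∀ n h : ℕ, p ∈ mF n h ↔ MP n h p := by
  induction p with
  | nil =>
    intro n h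
    rw [MP_nil]
    rcases n with _ | n <;> rcases h with _ | h <;>
      simp [mF, mem_pre_nil] <;> omega
  | cons s p ih =>
    intro n h
    rw [MP_cons]
    rcases n with _ | n <;> rcases h with _ | h
    · simp [mF]
    · simp [mF]
    · have e : (0:ℤ) ≤ ((0:ℕ):ℤ) := by simp
      have neg : ¬ MP n (-1) p := fun H => by have := MP_nonneg H; omega
      cases s <;> simp [mF, mem_pre_cons, ih, MStep.height, neg]
    · have e : (0:ℤ) ≤ (h:ℤ) + 1 := by omega
      have e2 : (h:ℤ) + 1 + 1 = h + 2 := by ring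
      cases s <;> simp [mF, mem_pre_cons, ih, MStep.height, e, e2]

theorem mem_cF (p : List SStep) : ∀ n j : ℕ, p ∈ cF n j ↔ SP (2 * n + j) j p := by
  induction p with
  | nil =>
    intro n h
    rw [SP_nil]
    rcases n with _ | n <;> rcases h with _ | h <;>
      simp [cF, mem_pre_nil]
  | cons s p ih =>
    intro n j
    rw [SP_cons]
    rcases n with _ | n <;> rcases j with _ | j
    · simp only [cF, Finset.mem_singleton, reduceCtorEq, false_iff]
      rintro ⟨-, -, m, hm, -⟩
      cases s <;> simp [SStep.width] at hm
    · cases s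
      · simp only [cF, mem_pre_cons, reduceCtorEq, false_and, false_iff]
        rintro ⟨-, -, m, hm, H⟩
        have := SP_le H
        simp [SStep.width, SStep.height] at hm this
        omega
      · simp only [cF, mem_pre_cons, reduceCtorEq, false_and, false_iff]
        rintro ⟨-, -, m, hm, H⟩
        have := SP_le H
        simp [SStep.width, SStep.height] at hm this
        omega
      · have e : (0:ℤ) ≤ (j:ℤ) + 1 := by omega
        simp [cF, mem_pre_cons, ih, SStep.width, SStep.height, e]
    · cases s
      · have e : ∀ m, 2 * (n + 1) = m + 1 ↔ m = 2 * n + 1 := by intro m; omega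
        simp [cF, mem_pre_cons, ih, SStep.width, SStep.height, e]
      · simp [cF, mem_pre_cons]
      · simp only [cF, mem_pre_cons, reduceCtorEq, false_and, false_iff]
        rintro ⟨-, -, m, hm, H⟩
        have := SP_nonneg H
        simp [SStep.height] at this
    · have e : (0:ℤ) ≤ (j:ℤ) + 1 := by omega
      have e' : (0:ℤ) < (j:ℤ) + 1 := by omega
      have e2 : (j:ℤ) + 1 + 1 = j + 2 := by ring
      cases s
      · have e3 : ∀ m, 2 * (n + 1) + (j + 1) = m + 1 ↔ m = 2 * n + (j + 2) := by intro m; omega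
        simp only [cF, Finset.mem_union, mem_pre_cons, ih, SStep.width, SStep.height, e3]
        simp [e, e2]
      · have e3 : ∀ m, 2 * (n + 1) + (j + 1) = m + 2 ↔ m = 2 * n + (j + 1) := by intro m; omega
        simp only [cF, Finset.mem_union, mem_pre_cons, ih, SStep.width, SStep.height, e3]
        simp [e, e']
      · have e3 : ∀ m, 2 * (n + 1) + (j + 1) = m + 1 ↔ m = 2 * (n + 1) + j := by intro m; omega
        simp only [cF, Finset.mem_union, mem_pre_cons, ih, SStep.width, SStep.height, e3]
        simp [e]

theorem card_mF_zero (n : ℕ) : (mF (n + 1) 0).card = (mF n 1).card + 3 * (mF n 0).card := by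
  rw [mF]
  repeat rw [Finset.card_union_of_disjoint (by simp [disj_pre])]
  simp only [card_pre]; ring

theorem card_mF_succ (n h : ℕ) : (mF (n + 1) (h + 1)).card =
    (mF n (h + 2)).card + 3 * (mF n (h + 1)).card + 2 * (mF n h).card := by
  rw [mF]
  repeat rw [Finset.card_union_of_disjoint (by simp [disj_pre])]
  simp only [card_pre]; ring

theorem card_cF_zero_succ (j : ℕ) : (cF 0 (j + 1)).card = (cF 0 j).card := by
  rw [cF, card_pre]

theorem card_cF_succ_zero (n : ℕ) : (cF (n + 1) 0).card = (cF n 1).card := by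
  rw [cF, card_pre]

theorem card_cF_succ (n j : ℕ) : (cF (n + 1) (j + 1)).card =
    (cF n (j + 2)).card + (cF n (j + 1)).card + (cF (n + 1) j).card := by
  rw [cF]
  repeat rw [Finset.card_union_of_disjoint (by simp [disj_pre])]
  simp only [card_pre]; ring

/-- Iterated differences: the coefficient of `x^n` in `L^a (L-1)^b s`. -/
def TT (n : ℕ) : ℕ → ℕ → ℤ
  | a, 0 => (cF n a).card
  | a, b + 1 => TT n (a + 1) b - TT n a b

theorem TT_zero (b : ℕ) : ∀ a, TT 0 a (b + 1) = 0 := by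
  induction b with
  | zero => intro a; simp [TT, card_cF_zero_succ]
  | succ b ih => intro a; rw [TT, ih, ih]; simp

theorem TT_succ (n b : ℕ) : ∀ a, TT (n + 1) a (b + 1) = TT n (a + 1) b + TT n (a + 2) b := by
  induction b with
  | zero => intro a; simp [TT, card_cF_succ]; ring
  | succ b ih => intro a; rw [TT, ih, ih]; simp only [TT]; ring

theorem card_mF_eq (n : ℕ) : ∀ h, ((mF n h).card : ℤ) = TT n 1 h := by
  induction n with
  | zero =>
    intro h
    rcases h with _ | h
    · simp [mF, TT, cF, card_pre]
    · rw [TT_zero]; simp [mF]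
  | succ n ih =>
    intro h
    rcases h with _ | h
    · rw [card_mF_zero]
      push_cast
      rw [ih, ih]
      simp only [TT]
      rw [card_cF_succ, card_cF_succ_zero]
      push_cast
      ring
    · rw [card_mF_succ, TT_succ]
      push_cast
      rw [ih, ih, ih]
      simp only [TT]
      ring

/-- For `n ≥ 1`, the number of (3,2)-Motzkin paths of length `n - 1` equals
the number of little Schröder paths of length `2n`. -/
theorem motzkin32_eq_schroeder_little (n : ℕ) (hn : 1 ≤ n) :
    m32 (n - 1) = SchroederLittle n := by
  obtain ⟨n, rfl⟩ := Nat.exists_eq_add_of_le' hn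
  have h1 : m32 n = (mF n 0).card := by
    rw [m32, ← Set.ncard_coe_finset]
    congr 1
    ext p
    simp [mem_mF, MP, IsMotzkin32]
  have h2 : SchroederLittle (n + 1) = (cF (n + 1) 0).card := by
    rw [SchroederLittle, ← Set.ncard_coe_finset]
    congr 1
    ext p
    simp [mem_cF, SP, IsLittleSchroeder, IsLargeSchroeder, and_assoc]
  rw [Nat.add_sub_cancel, h1, h2, card_cF_succ_zero]
  have := card_mF_eq n 0
  simp only [TT] at this
  exact_mod_cast this
end
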